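/- arXiv:1310.7004 — 3 statements merged into one kernel-verified Lean document; each statement's English description precedes it below -/
import Mathlib

section
/- For every positive integer n, every 2-colouring of the unordered pairs of {1, ..., 2^{⌈log₂ n⌉·(⌈log₂ n⌉+1)}} and every permutation π of [n], there exists a monochromatic copy of the ordered path on n vertices with edge pattern π: that is, vertices p_1 < ... < p_n and a single colour c such that all pairs {p_{π(i)}, p_{π(i+1)}}, i ∈ [n-1], have colour c. -/
lemma chain_aux {α : Type*} [DecidableEq α] (r : α → α → Prop) (n M : ℕ) (W : ℕ → Finset α)
    (hcard : ∀ l, l < n → 2 * M ≤ (W l).card)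
    (hM : 1 ≤ M)
    (hr : ∀ l, l + 1 < n → ∀ A ⊆ W l, ∀ B ⊆ W (l + 1), M ≤ A.card → M ≤ B.card →
      ∃ a ∈ A, ∃ b ∈ B, r a b) :
    ∀ i, i < n → ∃ R ⊆ W i, M ≤ R.card ∧ ∀ v ∈ R, ∃ f : ℕ → α, f i = v ∧
      (∀ l ≤ i, f l ∈ W l) ∧ ∀ l < i, r (f l) (f (l + 1)) := by
  classical
  intro i
  induction i with
  | zero =>
    intro h
    refine ⟨W 0, subset_rfl, by have := hcard 0 h; omega, fun v hv => ⟨fun _ => v, rfl, ?_, ?_⟩⟩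
    · intro l hl
      obtain rfl : l = 0 := by omega
      exact hv
    · intro l hl
      omega
  | succ i ih =>
    intro h
    obtain ⟨R, hRW, hRc, hR⟩ := ih (by omega)
    refine ⟨(W (i + 1)).filter (fun b => ∃ a ∈ R, r a b), Finset.filter_subset _ _, ?_, ?_⟩
    · by_contra hlt
      have h1 := Finset.card_filter_add_card_filter_not (s := W (i + 1)) (fun b => ∃ a ∈ R, r a b)
      have h2 := hcard (i + 1) h
      obtain ⟨a, ha, b, hb, hab⟩ := hr i h R hRW
        ((W (i + 1)).filter (fun b => ¬ ∃ a ∈ R, r a b)) (Finset.filter_subset _ _) hRc (by omega)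
      exact (Finset.mem_filter.1 hb).2 ⟨a, ha, hab⟩
    · intro v hv
      obtain ⟨hvW, a, ha, hav⟩ := Finset.mem_filter.1 hv
      obtain ⟨f, hfi, hfW, hfr⟩ := hR a ha
      refine ⟨fun l => if l ≤ i then f l else v, by simp, ?_, ?_⟩
      · intro l hl
        by_cases hli : l ≤ i
        · simpa [hli] using hfW l hli
        · obtain rfl : l = i + 1 := by omega
          simpa using hvW
      · intro l hl
        by_cases hli : l < i
        · have h1 : l ≤ i := by omega
          have h2 : l + 1 ≤ i := by omega
          simpa [h1, h2] using hfr l hli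
        · obtain rfl : l = i := by omega
          simpa [hfi] using hav

lemma blocks_aux {α : Type*} [LinearOrder α] (n K L : ℕ) (hK : n ≤ K) (S : Finset α)
    (hS : K * L ≤ S.card) :
    ∃ V : Fin n → Finset α, (∀ i, V i ⊆ S) ∧ (∀ i, (V i).card = L) ∧
      ∀ i j, i < j → ∀ a ∈ V i, ∀ b ∈ V j, a < b := by
  have key : ∀ (i : Fin n) (t : Fin L), i.1 * L + t.1 < K * L := by
    intro i t
    have h1 : (i.1 + 1) * L ≤ K * L := Nat.mul_le_mul_right _ (by omega)
    have := t.2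
    rw [Nat.add_mul] at h1
    omega
  let e := S.orderEmbOfCardLe hS
  refine ⟨fun i => Finset.univ.image (fun t : Fin L => e ⟨i.1 * L + t.1, key i t⟩), ?_, ?_, ?_⟩
  · intro i a ha
    obtain ⟨t, -, rfl⟩ := Finset.mem_image.1 ha
    exact Finset.orderEmbOfCardLe_mem S hS _
  · intro i
    rw [Finset.card_image_of_injective]
    · simp
    · intro t t' h
      have := e.injective h
      simp only [Fin.mk.injEq] at this
      ext
      omega
  · intro i j hij a ha b hb
    obtain ⟨t, -, rfl⟩ := Finset.mem_image.1 ha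
    obtain ⟨t', -, rfl⟩ := Finset.mem_image.1 hb
    apply e.strictMono
    rw [Fin.mk_lt_mk]
    have h1 : (i.1 + 1) * L ≤ j.1 * L := Nat.mul_le_mul_right _ hij
    have := t.2
    rw [Nat.add_mul] at h1
    omega

lemma main_aux {α : Type*} [LinearOrder α] (c : α → α → Bool) (hsym : ∀ a b, c a b = c b a)
    (n K : ℕ) (hn : 1 ≤ n) (hK : n ≤ K) (π : Equiv.Perm (Fin n)) (j : ℕ) :
    ∀ S : Finset α, (K * 2) ^ j ≤ S.card →
    (∃ p : Fin n → α, StrictMono p ∧ ∀ i : ℕ, ∀ h : i + 1 < n,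
        c (p (π ⟨i, Nat.lt_of_succ_lt h⟩)) (p (π ⟨i + 1, h⟩)) = true) ∨
    ∃ T : Finset α, T ⊆ S ∧ 2 ^ j ≤ T.card ∧ ∀ a ∈ T, ∀ b ∈ T, a ≠ b → c a b = false := by
  induction j with
  | zero =>
    intro S hS
    right
    obtain ⟨x, hx⟩ : S.Nonempty := Finset.card_pos.1 (by simpa using hS)
    refine ⟨{x}, by simpa using hx, by simp, ?_⟩
    intro a ha b hb hab
    simp_all
  | succ j ih =>
    intro S hS
    by_cases hp : ∃ p : Fin n → α, StrictMono p ∧ ∀ i : ℕ, ∀ h : i + 1 < n,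
        c (p (π ⟨i, Nat.lt_of_succ_lt h⟩)) (p (π ⟨i + 1, h⟩)) = true
    · exact Or.inl hp
    by_cases hAB : ∃ A ⊆ S, ∃ B ⊆ S, Disjoint A B ∧ (K * 2) ^ j ≤ A.card ∧ (K * 2) ^ j ≤ B.card ∧
        ∀ a ∈ A, ∀ b ∈ B, c a b = false
    · right
      obtain ⟨A, hA, B, hB, hd, hAc, hBc, hb⟩ := hAB
      obtain ⟨T, hTA, hTc, hT⟩ := (ih A hAc).resolve_left hp
      obtain ⟨U, hUB, hUc, hU⟩ := (ih B hBc).resolve_left hp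
      refine ⟨T ∪ U, Finset.union_subset (hTA.trans hA) (hUB.trans hB), ?_, ?_⟩
      · rw [Finset.card_union_of_disjoint (hd.mono hTA hUB), pow_succ]
        omega
      · intro a ha b hb' hab
        rcases Finset.mem_union.1 ha with ha | ha <;> rcases Finset.mem_union.1 hb' with hb' | hb'
        · exact hT a ha b hb' hab
        · exact hb a (hTA ha) b (hUB hb')
        · rw [hsym]
          exact hb b (hTA hb') a (hUB ha)
        · exact hU a ha b hb' hab
    · exfalso
      apply hp
      obtain ⟨V, hVS, hVc, hV⟩ := blocks_aux n K (2 * (K * 2) ^ j) hK S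
        (by rw [pow_succ] at hS; nlinarith)
      let W : ℕ → Finset α := fun l => if h : l < n then V (π ⟨l, h⟩) else ∅
      have hW : ∀ l (h : l < n), W l = V (π ⟨l, h⟩) := fun l h => by simp [W, h]
      obtain ⟨R, -, hRc, hR⟩ := chain_aux (fun a b => c a b = true) n ((K * 2) ^ j) W
        (fun l h => by rw [hW l h, hVc]) (Nat.one_le_pow _ _ (by omega))
        (by
          intro l hl A hA B hB hAc hBc
          by_contra hcon
          push Not at hcon
          rw [hW _ (Nat.lt_of_succ_lt hl)] at hA
          rw [hW _ hl] at hB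
          refine hAB ⟨A, hA.trans (hVS _), B, hB.trans (hVS _), ?_, hAc, hBc, ?_⟩
          · rw [Finset.disjoint_left]
            intro a ha hb
            have hne : π ⟨l, Nat.lt_of_succ_lt hl⟩ ≠ π ⟨l + 1, hl⟩ := by
              intro h
              have := π.injective h
              simp at this
            rcases lt_or_gt_of_ne hne with h | h
            · exact lt_irrefl _ (hV _ _ h a (hA ha) a (hB hb))
            · exact lt_irrefl _ (hV _ _ h a (hB hb) a (hA ha))
          · intro a ha b hb
            simpa using hcon a ha b hb)
        (n - 1) (by omega)
      obtain ⟨v, hv⟩ : R.Nonempty :=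
        Finset.card_pos.1 (lt_of_lt_of_le (Nat.one_le_pow _ _ (by omega)) hRc)
      obtain ⟨f, -, hfW, hfr⟩ := hR v hv
      have hmem : ∀ i : Fin n, f (π.symm i).1 ∈ V i := by
        intro i
        have := hfW (π.symm i).1 (by omega)
        rw [hW _ (π.symm i).2] at this
        simpa using this
      refine ⟨fun i => f (π.symm i).1, ?_, ?_⟩
      · intro i i' h
        exact hV i i' h _ (hmem i) _ (hmem i')
      · intro i h
        simpa using hfr i (by omega)



/-- Corollary `c:OrderedRamsey`: for every `n ≥ 1`, every symmetric
2-colouring of the pairs of `{1, …, 2^{⌈log₂ n⌉(⌈log₂ n⌉+1)}}` and every edge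
pattern `π` of an ordered path on `n` vertices, there is a monochromatic copy of
the ordered path: vertices `p 0 < … < p (n-1)` and a colour `c0` with all pairs
`{p (π i), p (π (i+1))}` of colour `c0`.  Here `⌈log₂ n⌉ = Nat.clog 2 n`. -/
theorem stmt_4 (n : ℕ) (hn : 1 ≤ n) (π : Equiv.Perm (Fin n))
    (c : Fin (2 ^ (Nat.clog 2 n * (Nat.clog 2 n + 1))) →
         Fin (2 ^ (Nat.clog 2 n * (Nat.clog 2 n + 1))) → Bool)
    (hsym : ∀ a b, c a b = c b a) :
    ∃ (c0 : Bool) (p : Fin n → Fin (2 ^ (Nat.clog 2 n * (Nat.clog 2 n + 1)))),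
      StrictMono p ∧
      ∀ i : ℕ, ∀ h : i + 1 < n,
        c (p (π ⟨i, Nat.lt_of_succ_lt h⟩)) (p (π ⟨i + 1, h⟩)) = c0 := by
  have hK : n ≤ 2 ^ Nat.clog 2 n := Nat.le_pow_clog (by norm_num) n
  rcases main_aux c hsym n (2 ^ Nat.clog 2 n) hn hK π (Nat.clog 2 n) Finset.univ
    (by rw [Finset.card_univ, Fintype.card_fin, ← pow_succ, ← pow_mul, mul_comm]) with
    ⟨p, hp, h⟩ | ⟨T, -, hTc, hT⟩
  · exact ⟨true, p, hp, h⟩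
  · let e := T.orderEmbOfCardLe (hK.trans hTc)
    refine ⟨false, e, e.strictMono, fun i h => ?_⟩
    refine hT _ (Finset.orderEmbOfCardLe_mem _ _ _) _ (Finset.orderEmbOfCardLe_mem _ _ _) ?_
    intro heq
    have := π.injective (e.injective heq)
    simp at this
end

section
/- For every n ≥ 1, every 2-colouring of the edges (straight-line segments) of the complete geometric graph on any set of 32n³ points in convex position contains a monochromatic non-crossing copy of the ladder graph L_{2n}. In other words, the convex geometric Ramsey number satisfies R_c(L_{2n}) ≤ 32n³. -/
/-- Points of the plane. -/
abbrev Pt : Type := ℝ × ℝ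

noncomputable section

/-- Cross product (orientation test) of the triple `(p, q, r)`. -/
def crossProd (p q r : Pt) : ℝ :=
  (q.1 - p.1) * (r.2 - p.2) - (q.2 - p.2) * (r.1 - p.1)

/-- Two segments cross iff they meet in a point interior to both. -/
def SegCross (a b c d : Pt) : Prop :=
  (openSegment ℝ a b ∩ openSegment ℝ c d).Nonempty

/-- A finite point set is in general position if no three of its points are collinear. -/
def GenPos (P : Finset Pt) : Prop :=
  ∀ p ∈ P, ∀ q ∈ P, ∀ r ∈ P, p ≠ q → p ≠ r → q ≠ r →
    ¬ Collinear ℝ ({p, q, r} : Set Pt)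

/-- A finite point set is in convex position if no point lies in the convex hull
of the others. -/
def ConvexPos (P : Finset Pt) : Prop :=
  ∀ p ∈ P, p ∉ convexHull ℝ ((P.erase p : Finset Pt) : Set Pt)

/-- Two finite point sets are mutually avoiding: both have at least two points, no
line through two points of one meets the convex hull of the other. -/
def MutuallyAvoiding (A B : Finset Pt) : Prop :=
  2 ≤ A.card ∧ 2 ≤ B.card ∧
  (∀ a ∈ A, ∀ a' ∈ A, a ≠ a' →
    Disjoint ((affineSpan ℝ ({a, a'} : Set Pt) : AffineSubspace ℝ Pt) : Set Pt)
      (convexHull ℝ (B : Set Pt))) ∧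
  (∀ b ∈ B, ∀ b' ∈ B, b ≠ b' →
    Disjoint ((affineSpan ℝ ({b, b'} : Set Pt) : AffineSubspace ℝ Pt) : Set Pt)
      (convexHull ℝ (A : Set Pt)))

/-- The canonical order on the first set `A` of a mutually avoiding pair `(A, B)`:
`p` precedes `q` iff every point of `B` sees the (ordered) pair `(p, q)` clockwise. -/
def precA (B : Finset Pt) (p q : Pt) : Prop := ∀ b ∈ B, crossProd b p q < 0

/-- The canonical order on the second set `B` of a mutually avoiding pair `(A, B)`:
`p` precedes `q` iff every point of `A` sees the (ordered) pair `(p, q)`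
counterclockwise. -/
def precB (A : Finset Pt) (p q : Pt) : Prop := ∀ a ∈ A, 0 < crossProd a p q

/-- The edge segments (as ordered pairs of endpoints) of the straight-line drawing of
the ladder graph `L_{2n}` with rails `x 0 — x 1 — ⋯ — x (n-1)` and
`y 0 — ⋯ — y (n-1)` and rungs `x i — y i`. -/
def ladderEdges (n : ℕ) (x y : Fin n → Pt) : Set (Pt × Pt) :=
  {e | (∃ i j : Fin n, (i : ℕ) + 1 = (j : ℕ) ∧ e = (x i, x j)) ∨
       (∃ i j : Fin n, (i : ℕ) + 1 = (j : ℕ) ∧ e = (y i, y j)) ∨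
       (∃ i : Fin n, e = (x i, y i))}

/-- A family of segments is non-crossing if no two distinct ones cross. -/
def NoncrossingEdges (E : Set (Pt × Pt)) : Prop :=
  ∀ e ∈ E, ∀ f ∈ E, e ≠ f → ¬ SegCross e.1 e.2 f.1 f.2

/-- Two finite point sets can be (strictly) separated by a line. -/
def SeparatedByLine (A B : Finset Pt) : Prop :=
  ∃ a b c : ℝ, (a ≠ 0 ∨ b ≠ 0) ∧ (∀ p ∈ A, a * p.1 + b * p.2 < c) ∧
    (∀ q ∈ B, c < a * q.1 + b * q.2)

/-- The 2-coloured complete geometric graph on `C` (colouring `χ`, assumed symmetric)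
contains a monochromatic non-crossing copy of the ladder graph `L_{2n}`. -/
def MonoNoncrossingLadder (n : ℕ) (C : Finset Pt) (χ : Pt → Pt → Bool) : Prop :=
  ∃ (c : Bool) (x y : Fin n → Pt),
    (∀ i, x i ∈ C) ∧ (∀ i, y i ∈ C) ∧
    Function.Injective (Sum.elim x y) ∧
    (∀ e ∈ ladderEdges n x y, χ e.1 e.2 = c) ∧
    NoncrossingEdges (ladderEdges n x y)

/-! ### Combinatorial part -/

/-- An index-level monochromatic ladder. -/
def Lad (n M : ℕ) (c : ℕ → ℕ → Bool) : Prop :=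
  ∃ (col : Bool) (X Y : ℕ → ℕ),
    (∀ i, i + 1 < n → X i < X (i+1) ∧ Y (i+1) < Y i ∧
      c (X i) (X (i+1)) = col ∧ c (Y i) (Y (i+1)) = col) ∧
    (∀ i, i < n → X i < Y i ∧ Y i < M ∧ c (X i) (Y i) = col)

theorem path_or_clique (c : ℕ → ℕ → Bool) (col : Bool) (m k : ℕ) (hm : 1 ≤ m) :
    ∀ S : Finset ℕ, m * (k + 1) ≤ S.card →
    (∃ X : ℕ → ℕ, (∀ i, i ≤ k → X i ∈ S) ∧
      ∀ i, i < k → X i < X (i+1) ∧ c (X i) (X (i+1)) = col) ∨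
    (∃ T, T ⊆ S ∧ m ≤ T.card ∧ ∀ a ∈ T, ∀ b ∈ T, a < b → c a b = !col) := by
  induction k with
  | zero =>
    intro S hS
    have : 0 < S.card := by omega
    obtain ⟨a, ha⟩ := Finset.card_pos.mp this
    exact Or.inl ⟨fun _ => a, fun _ _ => ha, fun i hi => by omega⟩
  | succ k ih =>
    intro S hS
    classical
    set S' := S.filter (fun b => ∃ a ∈ S, a < b ∧ c a b = col) with hS'
    set T := S.filter (fun b => ¬ ∃ a ∈ S, a < b ∧ c a b = col) with hT
    have hcard : S'.card + T.card = S.card :=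
      Finset.card_filter_add_card_filter_not _
    by_cases hTm : m ≤ T.card
    · refine Or.inr ⟨T, Finset.filter_subset _ _, hTm, ?_⟩
      intro a ha b hb hab
      have h1 := (Finset.mem_filter.mp hb).2
      have h2 : c a b ≠ col := fun h => h1 ⟨a, (Finset.mem_filter.mp ha).1, hab, h⟩
      revert h2; cases c a b <;> cases col <;> simp
    · have : m * (k + 1) ≤ S'.card := by
        have : m * (k + 1 + 1) = m * (k+1) + m := by ring
        omega
      rcases ih S' this with ⟨X, hX, hX2⟩ | ⟨T, hT, h⟩
      · obtain ⟨a, haS, ha, hac⟩ := (Finset.mem_filter.mp (hX 0 (Nat.zero_le _))).2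
        refine Or.inl ⟨fun i => Nat.casesOn i a X, ?_, ?_⟩
        · intro i hi
          cases i with
          | zero => exact haS
          | succ i => exact (Finset.mem_filter.mp (hX i (by omega))).1
        · intro i hi
          cases i with
          | zero => exact ⟨ha, hac⟩
          | succ i => exact hX2 i (by omega)
      · exact Or.inr ⟨T, hT.trans (Finset.filter_subset _ _), h⟩

theorem clique_lad (n M : ℕ) (c : ℕ → ℕ → Bool) (hsym : ∀ a b, c a b = c b a)
    (T : Finset ℕ) (hTM : ∀ a ∈ T, a < M) (hT : 2 * n ≤ T.card) (col : Bool)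
    (hc : ∀ a ∈ T, ∀ b ∈ T, a < b → c a b = col) : Lad n M c := by
  let Z := T.orderEmbOfCardLe hT
  have hZ : ∀ i, Z i ∈ T := fun i => T.orderEmbOfCardLe_mem hT i
  have hlt : ∀ i j : Fin (2*n), i < j → Z i < Z j := fun i j h => Z.strictMono h
  refine ⟨col, fun i => if h : i < 2 * n then Z ⟨i, h⟩ else 0,
    fun i => if h : 2 * n - 1 - i < 2 * n then Z ⟨2 * n - 1 - i, h⟩ else 0, ?_, ?_⟩
  · intro i hi
    have h1 : i < 2 * n := by omega
    have h2 : i + 1 < 2 * n := by omega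
    have h3 : 2 * n - 1 - i < 2 * n := by omega
    have h4 : 2 * n - 1 - (i+1) < 2 * n := by omega
    simp only [h1, h2, h3, h4, dite_true]
    have e1 : Z ⟨i, h1⟩ < Z ⟨i+1, h2⟩ := hlt _ _ (by simp)
    have e2 : Z ⟨2 * n - 1 - (i+1), h4⟩ < Z ⟨2 * n - 1 - i, h3⟩ := hlt _ _ (by
      rw [Fin.mk_lt_mk]; omega)
    exact ⟨e1, e2, hc _ (hZ _) _ (hZ _) e1, (hsym _ _).trans (hc _ (hZ _) _ (hZ _) e2)⟩
  · intro i hi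
    have h1 : i < 2 * n := by omega
    have h3 : 2 * n - 1 - i < 2 * n := by omega
    simp only [h1, h3, dite_true]
    have e1 : Z ⟨i, h1⟩ < Z ⟨2 * n - 1 - i, h3⟩ := hlt _ _ (by
      rw [Fin.mk_lt_mk]; omega)
    exact ⟨e1, hTM _ (hZ _), hc _ (hZ _) _ (hZ _) e1⟩

theorem bip_lad (n M : ℕ) (hn : 1 ≤ n) (c : ℕ → ℕ → Bool) (hsym : ∀ a b, c a b = c b a)
    (U V : Finset ℕ) (hUM : ∀ a ∈ U, a < M) (hVM : ∀ a ∈ V, a < M)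
    (hU : 2 * n ^ 2 ≤ U.card) (hV : 2 * n ^ 2 ≤ V.card) (col : Bool)
    (hlt : ∀ a ∈ U, ∀ b ∈ V, a < b) (hc : ∀ a ∈ U, ∀ b ∈ V, c a b = col) : Lad n M c := by
  obtain ⟨k, rfl⟩ : ∃ k, n = k + 1 := ⟨n - 1, by omega⟩
  have e : 2 * (k+1)^2 = (2 * (k+1)) * (k + 1) := by ring
  rw [e] at hU hV
  rcases path_or_clique c col (2 * (k+1)) k (by omega) U hU with ⟨X, hX, hX2⟩ | ⟨T, hT, hTc, h⟩
  swap
  · exact clique_lad _ M c hsym T (fun a ha => hUM a (hT ha)) hTc _ h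
  rcases path_or_clique c col (2 * (k+1)) k (by omega) V hV with ⟨Y, hY, hY2⟩ | ⟨T, hT, hTc, h⟩
  swap
  · exact clique_lad _ M c hsym T (fun a ha => hVM a (hT ha)) hTc _ h
  refine ⟨col, X, fun i => Y (k - i), ?_, ?_⟩
  · intro i hi
    have h1 := hX2 i (by omega)
    have h2 := hY2 (k - (i+1)) (by omega)
    have h3 : k - (i+1) + 1 = k - i := by omega
    rw [h3] at h2
    exact ⟨h1.1, h2.1, h1.2, (hsym _ _).trans h2.2⟩
  · intro i hi
    exact ⟨hlt _ (hX i (by omega)) _ (hY _ (by omega)), hVM _ (hY _ (by omega)),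
      hc _ (hX i (by omega)) _ (hY _ (by omega))⟩

theorem chain_lad (n M : ℕ) (hn : 1 ≤ n) (c : ℕ → ℕ → Bool) (hsym : ∀ a b, c a b = c b a)
    (col : Bool) (T : ℕ → Finset ℕ) (N : ℕ → ℕ → Finset ℕ)
    (hTM : ∀ k, k < n → ∀ a ∈ T k, a < M)
    (hT : ∀ k, k < n → 4 * n ^ 2 ≤ (T k).card)
    (hN : ∀ k, k < n → ∀ a ∈ T k, 4 * n ^ 2 ≤ (N k a).card)
    (hTN : ∀ k, k < n → ∀ a ∈ T k, ∀ b ∈ N k a, a < b ∧ b < M ∧ c a b = col)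
    (hTT : ∀ k, k + 1 < n → ∀ a ∈ T k, ∀ a' ∈ T (k+1), a < a')
    (hNN : ∀ k, k + 1 < n → ∀ a ∈ T k, ∀ a' ∈ T (k+1), ∀ b ∈ N k a, ∀ b' ∈ N (k+1) a', b' < b) :
    Lad n M c := by
  classical
  by_contra hL
  let LP : ℕ → ℕ → ℕ → Prop := fun k a b => ∃ X Y : ℕ → ℕ, X k = a ∧ Y k = b ∧
    (∀ i, i ≤ k → X i ∈ T i ∧ Y i ∈ N i (X i)) ∧
    (∀ i, i < k → c (X i) (X (i+1)) = col ∧ c (Y i) (Y (i+1)) = col)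
  have key : ∀ k, k < n → ∃ G, G ⊆ T k ∧ 2 * n ^ 2 ≤ G.card ∧
      ∀ a ∈ G, 2 * n ^ 2 ≤ ((N k a).filter (fun b => LP k a b)).card := by
    intro k
    induction k with
    | zero =>
      intro hk
      refine ⟨T 0, subset_rfl, by have := hT 0 hk; omega, ?_⟩
      intro a ha
      have h1 := hN 0 hk a ha
      have h2 : (N 0 a).filter (fun b => LP 0 a b) = N 0 a := by
        apply Finset.filter_true_of_mem
        intro b hb
        refine ⟨fun _ => a, fun _ => b, rfl, rfl, ?_, fun i hi => by omega⟩
        intro i hi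
        obtain rfl : i = 0 := by omega
        exact ⟨ha, hb⟩
      rw [h2]; omega
    | succ k ih =>
      intro hk
      obtain ⟨G, hG, hGc, hGN⟩ := ih (by omega)
      refine ⟨(T (k+1)).filter (fun a' => ∃ a ∈ G, c a a' = col), Finset.filter_subset _ _, ?_, ?_⟩
      · have h1 := Finset.card_filter_add_card_filter_not (s := T (k+1))
          (fun a' => ∃ a ∈ G, c a a' = col)
        have h2 := hT (k+1) hk
        by_contra hlt
        apply hL
        refine bip_lad n M hn c hsym G ((T (k+1)).filter (fun a' => ¬ ∃ a ∈ G, c a a' = col))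
          (fun a ha => hTM k (by omega) a (hG ha))
          (fun a ha => hTM (k+1) hk a (Finset.mem_filter.mp ha).1) hGc (by omega) (!col)
          (fun a ha b hb => hTT k hk a (hG ha) b (Finset.mem_filter.mp hb).1) ?_
        intro a ha b hb
        have h3 : c a b ≠ col := fun h => (Finset.mem_filter.mp hb).2 ⟨a, ha, h⟩
        revert h3; cases c a b <;> cases col <;> simp
      · intro a' ha'
        obtain ⟨ha'T, a, haG, hac⟩ := Finset.mem_filter.mp ha'
        set H := (N k a).filter (fun b => LP k a b) with hH
        have hHc : 2 * n ^ 2 ≤ H.card := hGN a haG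
        have hsub : (N (k+1) a').filter (fun b' => ∃ b ∈ H, c b b' = col) ⊆
            (N (k+1) a').filter (fun b' => LP (k+1) a' b') := by
          intro b' hb'
          obtain ⟨hb'N, b, hbH, hbc⟩ := Finset.mem_filter.mp hb'
          obtain ⟨hbN, X, Y, hXk, hYk, h1, h2⟩ := Finset.mem_filter.mp hbH
          refine Finset.mem_filter.mpr ⟨hb'N, Function.update X (k+1) a',
            Function.update Y (k+1) b', by simp, by simp, ?_, ?_⟩
          · intro i hi
            rcases Nat.lt_or_ge i (k+1) with h | h
            · rw [Function.update_of_ne (by omega), Function.update_of_ne (by omega)]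
              exact h1 i (by omega)
            · obtain rfl : i = k + 1 := by omega
              simp only [Function.update_self]
              exact ⟨ha'T, hb'N⟩
          · intro i hi
            rw [Function.update_of_ne (by omega : i ≠ k + 1),
              Function.update_of_ne (by omega : i ≠ k + 1)]
            rcases Nat.lt_or_ge i k with h | h
            · rw [Function.update_of_ne (by omega), Function.update_of_ne (by omega)]
              exact h2 i h
            · obtain rfl : i = k := by omega
              simp only [Function.update_self]
              rw [hXk, hYk]
              exact ⟨hac, hbc⟩
        refine le_trans ?_ (Finset.card_le_card hsub)
        have h1 := Finset.card_filter_add_card_filter_not (s := N (k+1) a')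
          (fun b' => ∃ b ∈ H, c b b' = col)
        have h2 := hN (k+1) hk a' ha'T
        by_contra hlt
        apply hL
        refine bip_lad n M hn c hsym ((N (k+1) a').filter (fun b' => ¬ ∃ b ∈ H, c b b' = col)) H
          (fun b hb => (hTN (k+1) hk a' ha'T b (Finset.mem_filter.mp hb).1).2.1)
          (fun b hb => (hTN k (by omega) a (hG haG) b (Finset.mem_filter.mp hb).1).2.1)
          (by omega) hHc (!col)
          (fun b' hb' b hb => hNN k hk a (hG haG) a' ha'T b (Finset.mem_filter.mp hb).1 b'
            (Finset.mem_filter.mp hb').1) ?_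
        intro b' hb' b hb
        have h3 : c b b' ≠ col := fun h => (Finset.mem_filter.mp hb').2 ⟨b, hb, h⟩
        rw [hsym]
        revert h3; cases c b b' <;> cases col <;> simp
  have hpos : 0 < n ^ 2 := by positivity
  obtain ⟨G, hG, hGc, hGN⟩ := key (n-1) (by omega)
  obtain ⟨a, ha⟩ := Finset.card_pos.mp (by omega : 0 < G.card)
  obtain ⟨b, hb⟩ := Finset.card_pos.mp (lt_of_lt_of_le (by omega) (hGN a ha))
  obtain ⟨-, X, Y, -, -, h1, h2⟩ := Finset.mem_filter.mp hb
  apply hL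
  refine ⟨col, X, Y, ?_, ?_⟩
  · intro i hi
    have p1 := h1 i (by omega)
    have p2 := h1 (i+1) (by omega)
    exact ⟨hTT i hi _ p1.1 _ p2.1, hNN i hi _ p1.1 _ p2.1 _ p1.2 _ p2.2, h2 i (by omega)⟩
  · intro i hi
    have p1 := h1 i (by omega)
    exact hTN i hi _ p1.1 _ p1.2

theorem bool_pigeon {α : Type*} (S : Finset α) (P : Bool → α → Prop)
    (h : ∀ a ∈ S, ∃ col, P col a) (m : ℕ) (hm : 2 * m ≤ S.card) :
    ∃ col, ∃ T ⊆ S, m ≤ T.card ∧ ∀ a ∈ T, P col a := by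
  classical
  by_cases h1 : m ≤ (S.filter (P true)).card
  · exact ⟨true, _, Finset.filter_subset _ _, h1, fun a ha => (Finset.mem_filter.mp ha).2⟩
  · have := Finset.card_filter_add_card_filter_not (s := S) (P true)
    refine ⟨false, S.filter (fun a => ¬ P true a), Finset.filter_subset _ _, by omega, ?_⟩
    intro a ha
    obtain ⟨ha, hp⟩ := Finset.mem_filter.mp ha
    obtain ⟨col, hcol⟩ := h a ha
    cases col
    · exact hcol
    · exact absurd hcol hp

theorem comb_main (n : ℕ) (hn : 1 ≤ n) (c : ℕ → ℕ → Bool) (hsym : ∀ a b, c a b = c b a) :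
    Lad n (32 * n ^ 3) c := by
  classical
  set s := 8 * n ^ 2 with hs
  set M := 32 * n ^ 3 with hM
  have hMs : M = 4 * n * s := by rw [hM, hs]; ring
  let A : ℕ → Finset ℕ := fun i => Finset.Ico (s * i) (s * (i+1))
  let B : ℕ → Finset ℕ := fun i => Finset.Ico (M - s * (i+1)) (M - s * i)
  have hle : ∀ i, i < 2 * n → 2 * (s * (i+1)) ≤ M := by
    intro i hi
    rw [hMs]
    nlinarith [Nat.mul_le_mul_left s (show i + 1 ≤ 2 * n by omega)]
  have hss : ∀ i, s * (i+1) = s * i + s := fun i => by ring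
  have hA : ∀ i, (A i).card = s := by
    intro i; simp only [A, Nat.card_Ico]; have := hss i; omega
  have hB : ∀ i, i < 2 * n → (B i).card = s := by
    intro i hi; simp only [B, Nat.card_Ico]; have := hss i; have := hle i hi; omega
  have hrow : ∀ i, i < 2 * n → ∀ a ∈ A i, ∃ col, 4 * n ^ 2 ≤
      ((B i).filter (fun b => c a b = col)).card := by
    intro i hi a ha
    obtain ⟨col, T, hT, hTc, h⟩ := bool_pigeon (B i) (fun col b => c a b = col)
      (fun b _ => ⟨_, rfl⟩) (4 * n ^ 2) (by rw [hB i hi]; omega)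
    refine ⟨col, hTc.trans (Finset.card_le_card ?_)⟩
    intro b hb
    exact Finset.mem_filter.mpr ⟨hT hb, h b hb⟩
  have hblock : ∀ i ∈ Finset.range (2 * n), ∃ col, ∃ T ⊆ A i, 4 * n ^ 2 ≤ T.card ∧
      ∀ a ∈ T, 4 * n ^ 2 ≤ ((B i).filter (fun b => c a b = col)).card := by
    intro i hi
    exact bool_pigeon (A i) _ (hrow i (Finset.mem_range.mp hi)) (4 * n ^ 2) (by rw [hA i]; omega)
  obtain ⟨col, I, hI, hIc, hIT⟩ := bool_pigeon (Finset.range (2*n)) _ hblock n (by simp)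
  choose! T hTA hTc hTN using hIT
  let Z := I.orderEmbOfCardLe hIc
  let z : ℕ → ℕ := fun k => if h : k < n then Z ⟨k, h⟩ else 0
  have hz : ∀ k, k < n → z k ∈ I := by
    intro k hk
    simp only [z, hk, dite_true]
    exact I.orderEmbOfCardLe_mem hIc _
  have hzl : ∀ k, k + 1 < n → z k < z (k+1) := by
    intro k hk
    have hk' : k < n := by omega
    simp only [z, hk, hk', dite_true]
    exact Z.strictMono (by simp)
  have hz2 : ∀ k, k < n → z k < 2 * n := fun k hk => Finset.mem_range.mp (hI (hz k hk))
  have memA : ∀ k, k < n → ∀ a ∈ T (z k), s * z k ≤ a ∧ a < s * (z k + 1) :=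
    fun k hk a ha => Finset.mem_Ico.mp (hTA _ (hz k hk) ha)
  have hmono : ∀ k, k + 1 < n → s * (z k + 1) ≤ s * z (k+1) :=
    fun k hk => Nat.mul_le_mul_left s (hzl k hk)
  have memB : ∀ i b col a, b ∈ (B i).filter (fun b => c a b = col) →
      M - s * (i+1) ≤ b ∧ b < M - s * i := by
    intro i b col a hb
    exact Finset.mem_Ico.mp (Finset.mem_filter.mp hb).1
  refine chain_lad n M hn c hsym col (fun k => T (z k))
    (fun k a => (B (z k)).filter (fun b => c a b = col)) ?_ ?_ ?_ ?_ ?_ ?_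
  · intro k hk a ha
    have := memA k hk a ha
    have := hle _ (hz2 k hk)
    omega
  · intro k hk; exact hTc _ (hz k hk)
  · intro k hk a ha; exact hTN _ (hz k hk) a ha
  · intro k hk a ha b hb
    have := memA k hk a ha
    have := hle _ (hz2 k hk)
    have := memB _ _ _ _ hb
    exact ⟨by omega, by omega, (Finset.mem_filter.mp hb).2⟩
  · intro k hk a ha a' ha'
    have := memA k (by omega) a ha
    have := memA (k+1) hk a' ha'
    have := hmono k hk
    omega
  · intro k hk a ha a' ha' b hb b' hb'
    have := memB _ _ _ _ hb
    have := memB _ _ _ _ hb'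
    have := hmono k hk
    omega

/-! ### Geometric part -/

theorem segCross_symm {a b c d : Pt} (h : SegCross a b c d) : SegCross c d a b := by
  unfold SegCross at *; rwa [Set.inter_comm]

theorem segCross_swap {a b c d : Pt} (h : SegCross a b c d) : SegCross b a c d := by
  unfold SegCross at *; rwa [openSegment_symm]

theorem segCross_swap' {a b c d : Pt} (h : SegCross a b c d) : SegCross a b d c := by
  unfold SegCross at *; rwa [openSegment_symm ℝ d c]

theorem segCross_comb {a b c d : Pt} (h : SegCross a b c d) :
    ∃ s t : ℝ, 0 < s ∧ 0 < t ∧ s * crossProd a b c + t * crossProd a b d = 0 := by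
  obtain ⟨z, ⟨u, v, hu, hv, huv, rfl⟩, ⟨s, t, hs, ht, hst, h⟩⟩ := h
  refine ⟨s, t, hs, ht, ?_⟩
  have h1 := congrArg Prod.fst h
  have h2 := congrArg Prod.snd h
  simp at h1 h2
  unfold crossProd
  obtain rfl : s = 1 - t := by linarith
  obtain rfl : u = 1 - v := by linarith
  linear_combination (b.1 - a.1) * h2 - (b.2 - a.2) * h1

theorem no_cross_pos {a b c d : Pt} (hc : 0 ≤ crossProd a b c) (hd : 0 ≤ crossProd a b d)
    (h : 0 < crossProd a b c ∨ 0 < crossProd a b d) : ¬ SegCross a b c d := by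
  intro hx
  obtain ⟨s, t, hs, ht, e⟩ := segCross_comb hx
  have h1 := mul_nonneg hs.le hc
  have h2 := mul_nonneg ht.le hd
  rcases h with h | h
  · have := mul_pos hs h; linarith
  · have := mul_pos ht h; linarith

/-- Points `p 0, …, p (M-1)` in counterclockwise convex order. -/
def CCW (M : ℕ) (p : ℕ → Pt) : Prop :=
  ∀ i j k, i < j → j < k → k < M → 0 < crossProd (p i) (p j) (p k)

theorem cross_rot (a b c : Pt) : crossProd a b c = crossProd b c a := by
  unfold crossProd; ring

theorem cross_self1 (a b : Pt) : crossProd a b a = 0 := by unfold crossProd; ring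
theorem cross_self2 (a b : Pt) : crossProd a b b = 0 := by unfold crossProd; ring

theorem ccw_out {M : ℕ} {p : ℕ → Pt} (hp : CCW M p) {i j k l : ℕ} (hij : i < j)
    (hk : k < M) (hl : l < M) (hj : j < M)
    (hk' : k ≤ i ∨ j ≤ k) (hl' : l ≤ i ∨ j ≤ l) (hne : (k ≠ i ∧ k ≠ j) ∨ (l ≠ i ∧ l ≠ j)) :
    ¬ SegCross (p i) (p j) (p k) (p l) := by
  have pos : ∀ m, m < M → (m < i ∨ j < m) → 0 < crossProd (p i) (p j) (p m) := by
    intro m hm h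
    rcases h with h | h
    · rw [← cross_rot]; exact hp _ _ _ h hij hj
    · exact hp _ _ _ hij h hm
  have nn : ∀ m, m < M → (m ≤ i ∨ j ≤ m) → 0 ≤ crossProd (p i) (p j) (p m) := by
    intro m hm h
    by_cases h1 : m = i
    · rw [h1, cross_self1]
    by_cases h2 : m = j
    · rw [h2, cross_self2]
    exact (pos m hm (by omega)).le
  apply no_cross_pos (nn k hk hk') (nn l hl hl')
  rcases hne with h | h
  · exact Or.inl (pos k hk (by omega))
  · exact Or.inr (pos l hl (by omega))

theorem ladder_of_lad (n : ℕ) (C : Finset Pt) (χ : Pt → Pt → Bool) (M : ℕ) (p : ℕ → Pt)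
    (hpC : ∀ i, i < M → p i ∈ C) (hinj : ∀ i j, i < M → j < M → p i = p j → i = j)
    (hp : CCW M p) (hL : Lad n M (fun i j => χ (p i) (p j))) : MonoNoncrossingLadder n C χ := by
  obtain ⟨col, X, Y, h1, h2⟩ := hL
  have hXm : ∀ j i, i < j → j < n → X i < X j := by
    intro j
    induction j with
    | zero => intro i hi; omega
    | succ j ih =>
      intro i hi hj
      have := (h1 j hj).1
      rcases Nat.lt_or_ge i j with h | h
      · have := ih i h (by omega); omega
      · obtain rfl : i = j := by omega
        exact this
  have hYm : ∀ j i, i < j → j < n → Y j < Y i := by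
    intro j
    induction j with
    | zero => intro i hi; omega
    | succ j ih =>
      intro i hi hj
      have := (h1 j hj).2.1
      rcases Nat.lt_or_ge i j with h | h
      · have := ih i h (by omega); omega
      · obtain rfl : i = j := by omega
        exact this
  have hXY : ∀ i j, i < n → j < n → X i < Y j := by
    intro i j hi hj
    have a := (h2 i hi).1
    have b := (h2 j hj).1
    rcases lt_trichotomy i j with h | h | h
    · have := hXm j i h hj; omega
    · subst h; exact a
    · have := hYm i j h hi; omega
  have hYM : ∀ i, i < n → Y i < M := fun i hi => (h2 i hi).2.1
  have hXM : ∀ i, i < n → X i < M := fun i hi => by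
    have := hYM i hi; have := (h2 i hi).1; omega
  have hXi : ∀ i j, i < n → j < n → X i = X j → i = j := by
    intro i j hi hj h
    rcases lt_trichotomy i j with h' | h' | h'
    · have := hXm j i h' hj; omega
    · exact h'
    · have := hXm i j h' hi; omega
  have hYi : ∀ i j, i < n → j < n → Y i = Y j → i = j := by
    intro i j hi hj h
    rcases lt_trichotomy i j with h' | h' | h'
    · have := hYm j i h' hj; omega
    · exact h'
    · have := hYm i j h' hi; omega
  -- gaps
  have gX : ∀ i j, i + 1 < n → j < n → X j ≤ X i ∨ X (i+1) ≤ X j := by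
    intro i j hi hj
    rcases lt_trichotomy j i with h | h | h
    · left; exact (hXm i j h (by omega)).le
    · left; rw [h]
    · right
      rcases Nat.lt_or_ge (i+1) j with h' | h'
      · exact (hXm j (i+1) h' hj).le
      · rw [show i + 1 = j by omega]
  have gY : ∀ i j, i + 1 < n → j < n → Y j ≤ Y (i+1) ∨ Y i ≤ Y j := by
    intro i j hi hj
    rcases lt_trichotomy j i with h | h | h
    · right; exact (hYm i j h (by omega)).le
    · right; rw [h]
    · left
      rcases Nat.lt_or_ge (i+1) j with h' | h'
      · exact (hYm j (i+1) h' hj).le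
      · rw [show i + 1 = j by omega]
  -- pairs of edges
  have XX : ∀ i j, i + 1 < n → j + 1 < n → i ≠ j →
      ¬ SegCross (p (X i)) (p (X (i+1))) (p (X j)) (p (X (j+1))) := by
    intro i j hi hj hne
    refine ccw_out hp (h1 i hi).1 (hXM _ (by omega)) (hXM _ hj) (hXM _ hi)
      (gX i j hi (by omega)) (gX i (j+1) hi hj) ?_
    have a1 := hXi j i (by omega) (by omega)
    have a2 := hXi j (i+1) (by omega) (by omega)
    have a3 := hXi (j+1) i (by omega) (by omega)
    have a4 := hXi (j+1) (i+1) (by omega) (by omega)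
    omega
  have YY : ∀ i j, i + 1 < n → j + 1 < n → i ≠ j →
      ¬ SegCross (p (Y i)) (p (Y (i+1))) (p (Y j)) (p (Y (j+1))) := by
    intro i j hi hj hne hx
    refine ccw_out hp (h1 i hi).2.1 (hYM _ (by omega)) (hYM _ hj) (hYM _ (by omega))
      (gY i j hi (by omega)) (gY i (j+1) hi hj) ?_ (segCross_swap hx)
    have a1 := hYi j i (by omega) (by omega)
    have a2 := hYi j (i+1) (by omega) (by omega)
    have a3 := hYi (j+1) i (by omega) (by omega)
    have a4 := hYi (j+1) (i+1) (by omega) (by omega)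
    omega
  have XYr : ∀ i j, i + 1 < n → j + 1 < n →
      ¬ SegCross (p (X i)) (p (X (i+1))) (p (Y j)) (p (Y (j+1))) := by
    intro i j hi hj
    have b1 := hXY (i+1) j hi (by omega)
    have b2 := hXY (i+1) (j+1) hi hj
    have b3 := (h1 i hi).1
    exact ccw_out hp b3 (hYM _ (by omega)) (hYM _ hj) (hXM _ hi)
      (by omega) (by omega) (by omega)
  have XR : ∀ i j, i + 1 < n → j < n →
      ¬ SegCross (p (X i)) (p (X (i+1))) (p (X j)) (p (Y j)) := by
    intro i j hi hj
    have b1 := hXY (i+1) j hi (by omega)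
    have b3 := (h1 i hi).1
    exact ccw_out hp b3 (hXM _ (by omega)) (hYM _ hj) (hXM _ hi)
      (gX i j hi hj) (by omega) (by omega)
  have YR : ∀ i j, i + 1 < n → j < n →
      ¬ SegCross (p (Y i)) (p (Y (i+1))) (p (X j)) (p (Y j)) := by
    intro i j hi hj hx
    have b1 := hXY j (i+1) hj hi
    have b3 := (h1 i hi).2.1
    exact ccw_out hp b3 (hXM _ (by omega)) (hYM _ hj) (hYM _ (by omega))
      (by omega) (gY i j hi hj) (by omega) (segCross_swap hx)
  have RR : ∀ i j, i < j → j < n →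
      ¬ SegCross (p (X i)) (p (Y i)) (p (X j)) (p (Y j)) := by
    intro i j hi hj hx
    have b1 := hXm j i hi hj
    have b2 := hYm j i hi hj
    have b3 := hXY j j hj hj
    exact ccw_out hp b3 (hXM _ (by omega)) (hYM _ (by omega)) (hYM _ (by omega))
      (by omega) (by omega) (by omega) (segCross_symm hx)
  refine ⟨col, fun i => p (X i), fun i => p (Y i), fun i => hpC _ (hXM _ i.2),
    fun i => hpC _ (hYM _ i.2), ?_, ?_, ?_⟩
  · rintro (i | i) (j | j) h <;> simp only [Sum.elim_inl, Sum.elim_inr] at h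
    · have := hXi _ _ i.2 j.2 (hinj _ _ (hXM _ i.2) (hXM _ j.2) h)
      rw [Fin.ext this]
    · have := hinj _ _ (hXM _ i.2) (hYM _ j.2) h
      have := hXY _ _ i.2 j.2
      omega
    · have := hinj _ _ (hYM _ i.2) (hXM _ j.2) h
      have := hXY _ _ j.2 i.2
      omega
    · have := hYi _ _ i.2 j.2 (hinj _ _ (hYM _ i.2) (hYM _ j.2) h)
      rw [Fin.ext this]
  · rintro e (⟨i, ⟨j, hj⟩, hij, rfl⟩ | ⟨i, ⟨j, hj⟩, hij, rfl⟩ | ⟨i, rfl⟩)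
    · simp only at hij; subst hij; exact (h1 i hj).2.2.1
    · simp only at hij; subst hij; exact (h1 i hj).2.2.2
    · exact (h2 i i.2).2.2
  · rintro e (⟨⟨i, hi⟩, ⟨j, hj⟩, hij, rfl⟩ | ⟨⟨i, hi⟩, ⟨j, hj⟩, hij, rfl⟩ | ⟨⟨i, hi⟩, rfl⟩) f
      (⟨⟨k, hk⟩, ⟨l, hl⟩, hkl, rfl⟩ | ⟨⟨k, hk⟩, ⟨l, hl⟩, hkl, rfl⟩ | ⟨⟨k, hk⟩, rfl⟩) hne hx <;>
      simp only at * <;> (try subst hij) <;> (try subst hkl)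
    · exact XX i k hj hl (fun h => hne (by subst h; rfl)) hx
    · exact XYr i k hj hl hx
    · exact XR i k hj hk hx
    · exact XYr k i hl hj (segCross_symm hx)
    · exact YY i k hj hl (fun h => hne (by subst h; rfl)) hx
    · exact YR i k hj hk hx
    · exact XR k i hl hi (segCross_symm hx)
    · exact YR k i hl hi (segCross_symm hx)
    · rcases lt_trichotomy i k with h | h | h
      · exact RR i k h hk hx
      · exact hne (by subst h; rfl)
      · exact RR k i h hi (segCross_symm hx)

theorem not_in_triangle {C : Finset Pt} (hC : ConvexPos C) {a b c d : Pt} (ha : a ∈ C)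
    (hb : b ∈ C) (hc : c ∈ C) (hd : d ∈ C) (hda : a ≠ d) (hdb : b ≠ d) (hdc : c ≠ d)
    (u v w : ℝ) (hu : 0 ≤ u) (hv : 0 ≤ v) (hw : 0 ≤ w) (huvw : u + v + w = 1)
    (e1 : d.1 = u * a.1 + v * b.1 + w * c.1) (e2 : d.2 = u * a.2 + v * b.2 + w * c.2) :
    False := by
  classical
  apply hC d hd
  have hmem : ∀ x ∈ C, x ≠ d → x ∈ convexHull ℝ ((C.erase d : Finset Pt) : Set Pt) := by
    intro x hx hxd
    apply subset_convexHull
    exact Finset.mem_coe.mpr (Finset.mem_erase.mpr ⟨hxd, hx⟩)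
  have := (convex_convexHull ℝ ((C.erase d : Finset Pt) : Set Pt)).sum_mem
    (t := Finset.univ) (w := ![u, v, w]) (z := ![a, b, c])
    (by intro i _; fin_cases i <;> simpa) (by simp [Fin.sum_univ_three, huvw])
    (by intro i _; fin_cases i
        · exact hmem a ha hda
        · exact hmem b hb hdb
        · exact hmem c hc hdc)
  convert this using 1
  simp only [Fin.sum_univ_three]
  ext <;> simp [e1, e2]

theorem exists_enum {α : Type*} [Fintype α] (r : α → α → Prop) [IsStrictTotalOrder α r]
    (k : ℕ) (hk : Fintype.card α = k) :
    ∃ F : Fin k → α, Function.Injective F ∧ ∀ i j, i < j → r (F i) (F j) := by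
  classical
  let _ : LinearOrder α := linearOrderOfSTO r
  let F := monoEquivOfFin α hk
  exact ⟨F, F.injective, fun i j h => F.strictMono h⟩

theorem exists_ccw (C : Finset Pt) (hC : ConvexPos C) (hne : C.Nonempty) :
    ∃ p : ℕ → Pt, (∀ i, i < C.card → p i ∈ C) ∧
      (∀ i j, i < C.card → j < C.card → p i = p j → i = j) ∧ CCW C.card p := by
  classical
  obtain ⟨o, hoC, hmin⟩ := C.exists_min_image (fun q => toLex q) hne
  have hlex : ∀ a ∈ C, a ≠ o → o.1 < a.1 ∨ (o.1 = a.1 ∧ o.2 < a.2) := by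
    intro a ha hao
    have h := lt_of_le_of_ne (hmin a ha) (fun h => hao (toLex.injective h).symm)
    simpa [Prod.Lex.toLex_lt_toLex] using h
  -- totality
  have htot : ∀ a ∈ C, ∀ b ∈ C, a ≠ o → b ≠ o → a ≠ b → crossProd o a b ≠ 0 := by
    have aux : ∀ a ∈ C, ∀ b ∈ C, a ≠ o → b ≠ o → a ≠ b → ∀ t : ℝ, 0 ≤ t → t ≤ 1 →
        b.1 - o.1 = t * (a.1 - o.1) → b.2 - o.2 = t * (a.2 - o.2) → False := by
      intro a ha b hb hao hbo hab t ht0 ht1 e1 e2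
      exact not_in_triangle hC hoC ha ha hb hbo.symm hab hab (1 - t) t 0 (by linarith) ht0 le_rfl
        (by ring) (by linarith) (by linarith)
    intro a ha b hb hao hbo hab h
    unfold crossProd at h
    rcases hlex a ha hao with h1 | ⟨h1, h1'⟩ <;> rcases hlex b hb hbo with h2 | ⟨h2, h2'⟩
    · rcases le_total (b.1 - o.1) (a.1 - o.1) with hl | hl
      · have hp : 0 < a.1 - o.1 := by linarith
        refine aux a ha b hb hao hbo hab ((b.1 - o.1) / (a.1 - o.1))
          (div_nonneg (by linarith) hp.le) ((div_le_one hp).mpr hl) ?_ ?_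
        · field_simp
        · field_simp; linarith
      · have hp : 0 < b.1 - o.1 := by linarith
        refine aux b hb a ha hbo hao hab.symm ((a.1 - o.1) / (b.1 - o.1))
          (div_nonneg (by linarith) hp.le) ((div_le_one hp).mpr hl) ?_ ?_
        · field_simp
        · field_simp; linarith
    · have : 0 < (a.1 - o.1) * (b.2 - o.2) := mul_pos (by linarith) (by linarith)
      rw [← h2] at h
      linarith
    · have : 0 < (a.2 - o.2) * (b.1 - o.1) := mul_pos (by linarith) (by linarith)
      rw [← h1] at h
      linarith
    · rcases le_total (b.2 - o.2) (a.2 - o.2) with hl | hl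
      · have hp : 0 < a.2 - o.2 := by linarith
        refine aux a ha b hb hao hbo hab ((b.2 - o.2) / (a.2 - o.2))
          (div_nonneg (by linarith) hp.le) ((div_le_one hp).mpr hl) ?_ ?_
        · rw [← h1, ← h2]; ring
        · field_simp
      · have hp : 0 < b.2 - o.2 := by linarith
        refine aux b hb a ha hbo hao hab.symm ((a.2 - o.2) / (b.2 - o.2))
          (div_nonneg (by linarith) hp.le) ((div_le_one hp).mpr hl) ?_ ?_
        · rw [← h1, ← h2]; ring
        · field_simp
  have htrans : ∀ a ∈ C, ∀ b ∈ C, ∀ d ∈ C, a ≠ o → b ≠ o → d ≠ o → 0 < crossProd o a b →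
      0 < crossProd o b d → 0 < crossProd o a d := by
    intro a ha b hb d hd hao hbo hdo h1 h2
    have i1 : (b.1 - o.1) * crossProd o a d =
      (a.1 - o.1) * crossProd o b d + (d.1 - o.1) * crossProd o a b := by
      unfold crossProd; ring
    have ha1 : 0 ≤ a.1 - o.1 := by rcases hlex a ha hao with h | ⟨h, -⟩ <;> linarith
    have hd1 : 0 ≤ d.1 - o.1 := by rcases hlex d hd hdo with h | ⟨h, -⟩ <;> linarith
    rcases hlex b hb hbo with hb1 | ⟨hb1, hb2⟩
    · have hbp : 0 < b.1 - o.1 := by linarith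
      rcases hlex a ha hao with ha2 | ⟨ha2, ha3⟩
      · have : 0 < (a.1 - o.1) * crossProd o b d := mul_pos (by linarith) h2
        have := mul_nonneg hd1 h1.le
        exact pos_of_mul_pos_right (by linarith : 0 < (b.1 - o.1) * crossProd o a d) hbp.le
      · exfalso
        unfold crossProd at h1
        rw [← ha2] at h1
        have := mul_pos (show 0 < a.2 - o.2 by linarith) hbp
        linarith
    · exfalso
      unfold crossProd at h2
      rw [← hb1] at h2
      have := mul_nonneg (show 0 ≤ b.2 - o.2 by linarith) hd1
      linarith
  have hconv : ∀ a ∈ C, ∀ b ∈ C, ∀ d ∈ C, a ≠ o → b ≠ o → d ≠ o → 0 < crossProd o a b →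
      0 < crossProd o b d → 0 < crossProd a b d := by
    intro a ha b hb d hd hao hbo hdo h1 h2
    have h3 := htrans a ha b hb d hd hao hbo hdo h1 h2
    by_contra h4
    have h5 : crossProd o b d + crossProd o a b ≤ crossProd o a d := by
      have : crossProd a b d = crossProd o b d + crossProd o a b - crossProd o a d := by
        unfold crossProd; ring
      linarith
    have hab : a ≠ b := by rintro rfl; rw [cross_self2] at h1; exact lt_irrefl _ h1
    have hbd : d ≠ b := by rintro rfl; rw [cross_self2] at h2; exact lt_irrefl _ h2
    have h3' := h3.ne'
    refine not_in_triangle hC hoC ha hd hb hbo.symm hab hbd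
      (1 - crossProd o b d / crossProd o a d - crossProd o a b / crossProd o a d)
      (crossProd o b d / crossProd o a d) (crossProd o a b / crossProd o a d) ?_
      (by positivity) (by positivity) (by ring) ?_ ?_
    · rw [sub_sub, ← add_div, sub_nonneg, div_le_one h3]; exact h5
    · field_simp
      unfold crossProd; ring
    · field_simp
      unfold crossProd; ring
  let r : {x // x ∈ C} → {x // x ∈ C} → Prop := fun a b =>
    b.1 ≠ o ∧ (a.1 = o ∨ 0 < crossProd o a.1 b.1)
  have hanti : ∀ a b, crossProd o a b = - crossProd o b a := by
    intro a b; unfold crossProd; ring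
  have hco : ∀ a, crossProd o a o = 0 := fun a => cross_self1 o a
  have hro : ∀ a b : {x // x ∈ C}, r a b → a.1 ≠ o → 0 < crossProd o a.1 b.1 := by
    intro a b h ha; exact h.2.resolve_left ha
  have : IsStrictTotalOrder {x // x ∈ C} r :=
    { irrefl := by
        intro a h
        have := hro a a h h.1
        rw [cross_self2] at this
        exact lt_irrefl _ this
      trans := by
        intro a b d h1 h2
        refine ⟨h2.1, ?_⟩
        by_cases ha : a.1 = o
        · exact Or.inl ha
        · exact Or.inr (htrans _ a.2 _ b.2 _ d.2 ha h1.1 h2.1 (hro _ _ h1 ha) (hro _ _ h2 h1.1))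
      trichotomous := by
        intro a b h1 h2
        by_contra hab
        have hab' : a.1 ≠ b.1 := fun h => hab (Subtype.ext h)
        by_cases ha : a.1 = o
        · exact h1 ⟨fun h => hab' (ha.trans h.symm), Or.inl ha⟩
        by_cases hb : b.1 = o
        · exact h2 ⟨ha, Or.inl hb⟩
        rcases lt_or_gt_of_ne (htot _ a.2 _ b.2 ha hb hab') with h | h
        · refine h2 ⟨ha, Or.inr ?_⟩
          rw [hanti]; linarith
        · exact h1 ⟨hb, Or.inr h⟩ }
  obtain ⟨F, hFi, hF⟩ := exists_enum r C.card (by simp)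
  refine ⟨fun i => if h : i < C.card then (F ⟨i, h⟩).1 else o, ?_, ?_, ?_⟩
  · intro i hi
    simp only [hi, dite_true]
    exact (F ⟨i, hi⟩).2
  · intro i j hi hj h
    simp only [hi, hj, dite_true] at h
    have := hFi (Subtype.ext h)
    simpa using this
  · intro i j k hij hjk hk
    have hj : j < C.card := by omega
    have hi : i < C.card := by omega
    simp only [hi, hj, hk, dite_true]
    have r1 := hF ⟨i, hi⟩ ⟨j, hj⟩ hij
    have r2 := hF ⟨j, hj⟩ ⟨k, hk⟩ hjk
    have p2 := hro _ _ r2 r1.1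
    by_cases ho : (F ⟨i, hi⟩).1 = o
    · rw [ho]; exact p2
    · exact hconv _ (F ⟨i, hi⟩).2 _ (F ⟨j, hj⟩).2 _ (F ⟨k, hk⟩).2 ho r1.1 r2.1 (hro _ _ r1 ho) p2

/-- Theorem `t:Ladder`: `R_c(L_{2n}) ≤ 32n³`: every symmetric
2-colouring of the complete geometric graph on any `32n³` points in convex position
contains a monochromatic non-crossing copy of the ladder graph `L_{2n}`. -/
theorem stmt_9 (n : ℕ) (hn : 1 ≤ n) (C : Finset Pt)
    (hcard : C.card = 32 * n ^ 3) (hC : ConvexPos C)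
    (χ : Pt → Pt → Bool) (hsym : ∀ p q, χ p q = χ q p) :
    MonoNoncrossingLadder n C χ := by
  obtain ⟨p, hpC, hinj, hp⟩ := exists_ccw C hC
    (Finset.card_pos.mp (by rw [hcard]; positivity))
  rw [hcard] at hpC hinj hp
  exact ladder_of_lad n C χ _ p hpC hinj hp
    (comb_main n hn (fun i j => χ (p i) (p j)) (fun a b => hsym _ _))

end
end

section
/- Let G be an outerplanar triangulation whose vertex set can be partitioned into V_u and V_v such that the induced subgraphs G[V_u] and G[V_v] are paths P_u = (x_1, ..., x_{n₁}) and P_v = (y_1, ..., y_{n₂}). Then there exist unique sequences of stem vertices u_1, ..., u_{ℓ−1} on P_u and v_1, ..., v_ℓ on P_v with v_1 = y_1 and v_ℓ = y_{n₂} such that the alternating sequence v_1, u_1, v_2, u_2, ..., u_{ℓ−1}, v_ℓ is a path in G; moreover 2ℓ − 1 ≤ n₁ + n₂, and every non-stem (leaf) vertex of P_u has exactly one neighbour in P_v, and vice versa. -/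
/-- Two chords `{a,b}` and `{c,d}` (with `a < b`, `c < d`) of a convex polygon whose
vertices are indexed `0, 1, …, N-1` in cyclic (convex-position) order cross iff
their endpoints interleave. -/
def ChordsCross {N : ℕ} (a b c d : Fin N) : Prop :=
  (a < c ∧ c < b ∧ b < d) ∨ (c < a ∧ a < d ∧ d < b)

/-- `G` is an outerplanar triangulation: for some cyclic labelling `σ` of the
vertices (placing them in convex position), `G` contains the Hamiltonian boundary
cycle, its edges drawn as chords are pairwise non-crossing, and it has the maximum
possible number `2N - 3` of edges (i.e. all bounded faces are triangles). -/
def IsOuterplanarTriangulation {N : ℕ} (G : SimpleGraph (Fin N))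
    [DecidableRel G.Adj] : Prop :=
  3 ≤ N ∧ ∃ σ : Equiv.Perm (Fin N),
    (∀ i j : Fin N, ((i : ℕ) + 1) % N = (j : ℕ) → G.Adj (σ i) (σ j)) ∧
    (∀ a b c d : Fin N, a < b → c < d →
      G.Adj (σ a) (σ b) → G.Adj (σ c) (σ d) → ¬ ChordsCross a b c d) ∧
    G.edgeFinset.card = 2 * N - 3

/-- The subgraph of `G` induced on `S` is a path: there is an enumeration
`x 0, x 1, …` of `S` such that two elements of `S` are adjacent in `G` iff they are
consecutive in the enumeration. -/
def IsInducedPathOn {N : ℕ} (G : SimpleGraph (Fin N)) (S : Finset (Fin N)) : Prop :=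
  ∃ (k : ℕ) (x : Fin k → Fin N), Function.Injective x ∧
    (∀ v : Fin N, v ∈ S ↔ ∃ i, x i = v) ∧
    (∀ i j : Fin k, G.Adj (x i) (x j) ↔ ((i : ℕ) + 1 = j ∨ (j : ℕ) + 1 = i))

/-- `G ∈ PW₂(N)`: `G` is an outerplanar triangulation whose vertex set is
partitioned into two sets each inducing a path. -/
def MemPW2 {N : ℕ} (G : SimpleGraph (Fin N)) [DecidableRel G.Adj] : Prop :=
  IsOuterplanarTriangulation G ∧
  ∃ Vu Vv : Finset (Fin N), Disjoint Vu Vv ∧ Vu ∪ Vv = Finset.univ ∧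
    IsInducedPathOn G Vu ∧ IsInducedPathOn G Vv


/-- `L` is the alternating stem path: a (nonempty, repetition-free) path of `G`
whose vertices at even positions lie in `Vv` and at odd positions in `Vu`, starting
at the first vertex `y 0` of the path `P_v` and ending at its last vertex
`y (n₂ - 1)`. -/
def IsStemPath {N n₂ : ℕ} (G : SimpleGraph (Fin N)) (Vu Vv : Finset (Fin N))
    (y : Fin n₂ → Fin N) (h : 0 < n₂) (L : List (Fin N)) : Prop :=
  L ≠ [] ∧ L.Nodup ∧ List.Chain' G.Adj L ∧
  (∀ i : ℕ, ∀ hi : i < L.length,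
    (Even i → L.get ⟨i, hi⟩ ∈ Vv) ∧ (¬ Even i → L.get ⟨i, hi⟩ ∈ Vu)) ∧
  L.head? = some (y ⟨0, h⟩) ∧
  L.getLast? = some (y ⟨n₂ - 1, Nat.sub_lt h Nat.one_pos⟩)


lemma step_id_or_rev (n : ℕ) (r : ℕ → ℕ) (hlt : ∀ j < n, r j < n)
    (hinj : ∀ i < n, ∀ j < n, r i = r j → i = j)
    (hstep : ∀ j, j + 1 < n → r j + 1 = r (j+1) ∨ r (j+1) + 1 = r j) :
    (∀ j < n, r j = j) ∨ (∀ j < n, r j = n - 1 - j) := by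
  by_cases hn : n ≤ 1
  · left
    intro j hj
    have := hlt j hj
    omega
  have h01 := hstep 0 (by omega)
  rcases h01 with h | h
  · left
    have key : ∀ j, j + 1 < n → r j + 1 = r (j+1) := by
      intro j
      induction j with
      | zero => intro _; exact h
      | succ j ih =>
        intro hj
        have h1 := ih (by omega)
        rcases hstep (j+1) hj with h2 | h2
        · exact h2
        · have := hinj j (by omega) (j+1+1) hj (by omega)
          omega
    have key2 : ∀ j, j < n → r j = r 0 + j := by
      intro j
      induction j with
      | zero => intro _; rfl
      | succ j ih =>
        intro hj
        have := ih (by omega)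
        have := key j hj
        omega
    intro j hj
    have h1 := key2 j hj
    have h2 := key2 (n-1) (by omega)
    have h3 := hlt (n-1) (by omega)
    omega
  · right
    have key : ∀ j, j + 1 < n → r (j+1) + 1 = r j := by
      intro j
      induction j with
      | zero => intro _; exact h
      | succ j ih =>
        intro hj
        have h1 := ih (by omega)
        rcases hstep (j+1) hj with h2 | h2
        · have := hinj j (by omega) (j+1+1) hj (by omega)
          omega
        · exact h2
    have key2 : ∀ j, j < n → r j + j = r 0 := by
      intro j
      induction j with
      | zero => intro _; rfl
      | succ j ih =>
        intro hj
        have := ih (by omega)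
        have := key j hj
        omega
    intro j hj
    have h1 := key2 j hj
    have h2 := key2 (n-1) (by omega)
    have h3 := hlt 0 (by omega)
    omega

lemma path_const {V : Type*} {n : ℕ} (y : Fin n → V) (P : V → Prop)
    (h : ∀ i j : Fin n, (i : ℕ) + 1 = j → (P (y i) ↔ P (y j))) :
    ∀ i j : Fin n, P (y i) ↔ P (y j) := by
  have key : ∀ k (hk : k < n), P (y ⟨0, by omega⟩) ↔ P (y ⟨k, hk⟩) := by
    intro k
    induction k with
    | zero => intro _; rfl
    | succ k ih =>
      intro hk
      exact (ih (by omega)).trans (h ⟨k, by omega⟩ ⟨k+1, hk⟩ rfl)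
  intro i j
  exact (key i i.2).symm.trans (key j j.2)

/-- Monochromatic edges do not separate the other colour. -/
lemma sep_lemma {N : ℕ} (G : SimpleGraph (Fin N)) (g : ℕ → Fin N)
    (hsurj : ∀ v, ∃ t < N, g t = v)
    (hinj : ∀ s < N, ∀ t < N, g s = g t → s = t)
    (hnc : ∀ a c b d, a < c → c < b → b < d → d < N → G.Adj (g a) (g b) → ¬ G.Adj (g c) (g d))
    (W : Finset (Fin N)) {n : ℕ} (y : Fin n → Fin N)
    (hyr : ∀ v : Fin N, v ∈ W ↔ ∃ i, y i = v)
    (hyp : ∀ i j : Fin n, (i : ℕ) + 1 = j → G.Adj (y i) (y j))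
    (a b : ℕ) (hab : a < b) (hb : b < N) (hadj : G.Adj (g a) (g b))
    (ha' : g a ∉ W) (hb' : g b ∉ W) (c d : ℕ) (hc : c < N) (hd : d < N)
    (hcW : g c ∈ W) (hdW : g d ∈ W) : (a < c ∧ c < b) ↔ (a < d ∧ d < b) := by
  have h := path_const y (fun v => ∃ t < N, g t = v ∧ a < t ∧ t < b) (by
    intro i j hij
    have hA := hyp i j hij
    obtain ⟨s, hs, hsi⟩ := hsurj (y i)
    obtain ⟨t, ht, htj⟩ := hsurj (y j)
    have hsW : g s ∈ W := (hyr _).2 ⟨i, hsi.symm⟩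
    have htW : g t ∈ W := (hyr _).2 ⟨j, htj.symm⟩
    rw [← hsi, ← htj] at hA ⊢
    have hsa : s ≠ a := fun e => ha' (e ▸ hsW)
    have hsb : s ≠ b := fun e => hb' (e ▸ hsW)
    have hta : t ≠ a := fun e => ha' (e ▸ htW)
    have htb : t ≠ b := fun e => hb' (e ▸ htW)
    have key : (a < s ∧ s < b) ↔ (a < t ∧ t < b) := by
      constructor
      · rintro ⟨h1, h2⟩
        by_contra hcon
        rcases Nat.lt_or_ge t a with h3 | h3
        · exact hnc t a s b h3 h1 h2 hb hA.symm hadj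
        · exact hnc a s b t h1 h2 (by omega) ht hadj hA
      · rintro ⟨h1, h2⟩
        by_contra hcon
        rcases Nat.lt_or_ge s a with h3 | h3
        · exact hnc s a t b h3 h1 h2 hb hA hadj
        · exact hnc a t b s h1 h2 (by omega) hs hadj hA.symm
    constructor
    · rintro ⟨r, hr, hrs, h1⟩
      obtain rfl := hinj r hr s hs hrs
      exact ⟨t, ht, rfl, key.1 h1⟩
    · rintro ⟨r, hr, hrs, h1⟩
      obtain rfl := hinj r hr t ht hrs
      exact ⟨s, hs, rfl, key.2 h1⟩)
  obtain ⟨i, hi⟩ := (hyr _).1 hcW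
  obtain ⟨j, hj⟩ := (hyr _).1 hdW
  have h := h i j
  simp only [hi, hj] at h
  constructor
  · intro h1
    obtain ⟨r, hr, e, h2⟩ := h.1 ⟨c, hc, rfl, h1⟩
    rwa [hinj r hr d hd e] at h2
  · intro h1
    obtain ⟨r, hr, e, h2⟩ := h.2 ⟨d, hd, rfl, h1⟩
    rwa [hinj r hr c hc e] at h2

/-- The two colours do not alternate around the cycle. -/
lemma no_alt {N : ℕ} (G : SimpleGraph (Fin N)) (g : ℕ → Fin N)
    (hsurj : ∀ v, ∃ t < N, g t = v)
    (hinj : ∀ s < N, ∀ t < N, g s = g t → s = t)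
    (hnc : ∀ a c b d, a < c → c < b → b < d → d < N → G.Adj (g a) (g b) → ¬ G.Adj (g c) (g d))
    (U W : Finset (Fin N)) (hdis : ∀ v ∈ U, v ∉ W) {n m : ℕ} (x : Fin m → Fin N) (y : Fin n → Fin N)
    (hxr : ∀ v : Fin N, v ∈ U ↔ ∃ i, x i = v)
    (hyr : ∀ v : Fin N, v ∈ W ↔ ∃ i, y i = v)
    (hxp : ∀ i j : Fin m, (i : ℕ) + 1 = j → G.Adj (x i) (x j))
    (hyp : ∀ i j : Fin n, (i : ℕ) + 1 = j → G.Adj (y i) (y j))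
    (a b c d : ℕ) (hab : a < b) (hbc : b < c) (hcd : c < d) (hd : d < N)
    (ha : g a ∈ U) (hb : g b ∈ W) (hc : g c ∈ U) (hdW : g d ∈ W) : False := by
  have sep := sep_lemma G g hsurj hinj hnc W y hyr hyp
  have key : ∀ s t, s < N → t < N → g s ∈ U → g t ∈ U → G.Adj (g s) (g t) →
      (b < s ∧ s < d) → (b < t ∧ t < d) := by
    intro s t hs ht hsU htU hA h1
    by_contra hcon
    have htb : t ≠ b := fun e => hdis _ htU (e ▸ hb)
    have htd : t ≠ d := fun e => hdis _ htU (e ▸ hdW)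
    rcases Nat.lt_or_ge t b with h3 | h3
    · have := sep t s (by omega) hs hA.symm (hdis _ htU) (hdis _ hsU) b d (by omega) hd hb hdW
      omega
    · have := sep s t (by omega) ht hA (hdis _ hsU) (hdis _ htU) b d (by omega) hd hb hdW
      omega
  have h := path_const x (fun v => ∃ t < N, g t = v ∧ b < t ∧ t < d) (by
    intro i j hij
    have hA := hxp i j hij
    obtain ⟨s, hs, hsi⟩ := hsurj (x i)
    obtain ⟨t, ht, htj⟩ := hsurj (x j)
    have hsW : g s ∈ U := (hxr _).2 ⟨i, hsi.symm⟩
    have htW : g t ∈ U := (hxr _).2 ⟨j, htj.symm⟩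
    rw [← hsi, ← htj] at hA ⊢
    constructor
    · rintro ⟨r, hr, hrs, h1⟩
      obtain rfl := hinj r hr s hs hrs
      exact ⟨t, ht, rfl, key _ _ hs ht hsW htW hA h1⟩
    · rintro ⟨r, hr, hrs, h1⟩
      obtain rfl := hinj r hr t ht hrs
      exact ⟨s, hs, rfl, key _ _ ht hs htW hsW hA.symm h1⟩)
  obtain ⟨i, hi⟩ := (hxr _).1 ha
  obtain ⟨j, hj⟩ := (hxr _).1 hc
  have h := h i j
  simp only [hi, hj] at h
  obtain ⟨r, hr, e, h2⟩ := h.2 ⟨c, by omega, rfl, by omega⟩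
  have := hinj r hr a (by omega) e
  omega

/-- Unrolling and rotating the outer cycle. -/
lemma rotate_exists {N : ℕ} (G : SimpleGraph (Fin N)) (σ : Equiv.Perm (Fin N)) (hN : 3 ≤ N)
    (hcyc : ∀ i j : Fin N, ((i : ℕ) + 1) % N = (j : ℕ) → G.Adj (σ i) (σ j))
    (hnc : ∀ a b c d : Fin N, a < c → c < b → b < d → 
      G.Adj (σ a) (σ b) → ¬ G.Adj (σ c) (σ d))
    (U : Finset (Fin N)) (hU : ∃ v, v ∈ U) (hU' : ∃ v, v ∉ U) :
    ∃ g : ℕ → Fin N, (∀ v, ∃ t < N, g t = v) ∧ (∀ s < N, ∀ t < N, g s = g t → s = t) ∧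
      (∀ a c b d, a < c → c < b → b < d → d < N → G.Adj (g a) (g b) → ¬ G.Adj (g c) (g d)) ∧
      (∀ t, G.Adj (g t) (g (t+1))) ∧ g 0 ∈ U ∧ g (N-1) ∉ U := by
  have hN0 : 0 < N := by omega
  let f : ℕ → Fin N := fun t => σ ⟨t % N, Nat.mod_lt _ hN0⟩
  have hmod : ∀ s t, s % N = t % N → f s = f t := by
    intro s t h
    simp only [f, h]
  have hmod' : ∀ s t, f s = f t → s % N = t % N := by
    intro s t h
    simpa [f] using h
  have hfs : ∀ v, ∃ t < N, f t = v := by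
    intro v
    refine ⟨(σ.symm v : Fin N), (σ.symm v).2, ?_⟩
    simp [f, Nat.mod_eq_of_lt (σ.symm v).2]
  have hfa : ∀ t, G.Adj (f t) (f (t+1)) := by
    intro t
    apply hcyc
    simp
  -- find the transition
  obtain ⟨v, hv⟩ := hU'
  obtain ⟨u, hu⟩ := hU
  obtain ⟨i0, hi0, rfl⟩ := hfs v
  obtain ⟨j0, hj0, rfl⟩ := hfs u
  have hex : ∃ k, f (i0 + k) ∈ U := ⟨j0 + N - i0, by
    rw [hmod (i0 + (j0 + N - i0)) j0]
    · exact hu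
    · rw [show i0 + (j0 + N - i0) = j0 + N by omega]; simp⟩
  classical
  obtain ⟨k, hkU, hkU'⟩ : ∃ k, f (k+1) ∈ U ∧ f k ∉ U := by
    have h0 : Nat.find hex ≠ 0 := by
      intro h
      have := Nat.find_spec hex
      rw [h] at this
      exact hv this
    refine ⟨i0 + (Nat.find hex - 1), ?_, ?_⟩
    · rw [show i0 + (Nat.find hex - 1) + 1 = i0 + Nat.find hex by omega]
      exact Nat.find_spec hex
    · exact Nat.find_min hex (by omega)
  set k' := (k+1) % N with hk'
  have hk'N : k' < N := Nat.mod_lt _ hN0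
  have hval : ∀ t < N, (t + k') % N = if t + k' < N then t + k' else t + k' - N := by
    intro t ht
    split_ifs with h
    · exact Nat.mod_eq_of_lt h
    · rw [Nat.mod_eq_sub_mod (by omega), Nat.mod_eq_of_lt (by omega)]
  refine ⟨fun t => f (t + k'), ?_, ?_, ?_, ?_, ?_, ?_⟩
  · intro v
    obtain ⟨t, ht, rfl⟩ := hfs v
    by_cases h : k' ≤ t
    · exact ⟨t - k', by omega, by simp only [Nat.sub_add_cancel h]⟩
    · refine ⟨t + N - k', by omega, ?_⟩
      apply hmod
      rw [show t + N - k' + k' = t + N by omega]; simp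
  · intro s hs t ht h
    have h := hmod' _ _ h
    rw [hval s hs, hval t ht] at h
    split_ifs at h <;> omega
  · intro a c b d h1 h2 h3 h4 hA hB
    have ea := hval a (by omega)
    have eb := hval b (by omega)
    have ec := hval c (by omega)
    have ed := hval d (by omega)
    have hlt : ∀ p q, (p % N < q % N) →
      (⟨p % N, Nat.mod_lt _ hN0⟩ : Fin N) < ⟨q % N, Nat.mod_lt _ hN0⟩ := fun p q h => h
    by_cases ca : a + k' < N
    · by_cases cc : c + k' < N
      · by_cases cb : b + k' < N
        · by_cases cd : d + k' < N
          · simp only [ca, cb, cc, cd, if_true] at ea eb ec ed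
            exact hnc _ _ _ _ (hlt (a+k') (c+k') (by omega)) (hlt _ (b+k') (by omega))
              (hlt _ (d+k') (by omega)) hA hB
          · simp only [ca, cb, cc, cd, if_true, if_false] at ea eb ec ed
            exact hnc _ _ _ _ (hlt (d+k') (a+k') (by omega)) (hlt _ (c+k') (by omega))
              (hlt _ (b+k') (by omega)) hB.symm hA
        · have cd : ¬ d + k' < N := by omega
          simp only [ca, cb, cc, cd, if_true, if_false] at ea eb ec ed
          exact hnc _ _ _ _ (hlt (b+k') (d+k') (by omega)) (hlt _ (a+k') (by omega))
              (hlt _ (c+k') (by omega)) hA.symm hB.symm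
      · have cd : ¬ d + k' < N := by omega
        have cb : ¬ b + k' < N := by omega
        simp only [ca, cb, cc, cd, if_true, if_false] at ea eb ec ed
        exact hnc _ _ _ _ (hlt (c+k') (b+k') (by omega)) (hlt _ (d+k') (by omega))
              (hlt _ (a+k') (by omega)) hB hA.symm
    · have cd : ¬ d + k' < N := by omega
      have cb : ¬ b + k' < N := by omega
      have cc : ¬ c + k' < N := by omega
      simp only [ca, cb, cc, cd, if_false] at ea eb ec ed
      exact hnc _ _ _ _ (hlt (a+k') (c+k') (by omega)) (hlt _ (b+k') (by omega))
              (hlt _ (d+k') (by omega)) hA hB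
  · intro t
    have := hfa (t + k')
    show G.Adj (f (t + k')) (f (t + 1 + k'))
    rw [show t + 1 + k' = t + k' + 1 by omega]
    exact this
  · show f (0 + k') ∈ U
    rw [hmod (0+k') (k+1)]
    · exact hkU
    · simp [hk']
  · show f (N - 1 + k') ∉ U
    rw [hmod (N-1+k') k]
    · exact hkU'
    · rw [hk', Nat.add_mod_mod, show N - 1 + (k+1) = k + N by omega]; simp

/-- The bipartite graph of edges joining `U` with its complement. -/
def crossGraph {N : ℕ} (G : SimpleGraph (Fin N)) (U : Finset (Fin N)) : SimpleGraph (Fin N) where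
  Adj v w := G.Adj v w ∧ (v ∈ U ↔ w ∉ U)
  symm := ⟨fun v w h => ⟨h.1.symm, by tauto⟩⟩
  loopless := ⟨fun v h => G.loopless.irrefl v h.1⟩

lemma diag_surj {n₁ n₂ : ℕ} (C : Finset (Fin n₁ × Fin n₂)) (hn₁ : 0 < n₁) (hn₂ : 0 < n₂)
    (hchain : ∀ p ∈ C, ∀ q ∈ C, p.1 < q.1 → p.2 ≤ q.2)
    (hcard : n₁ + n₂ - 1 ≤ C.card) :
    C.card = n₁ + n₂ - 1 ∧ ∀ s < n₁ + n₂ - 1, ∃ p ∈ C, (p.1 : ℕ) + p.2 = s := by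
  have hinj : Set.InjOn (fun p : Fin n₁ × Fin n₂ => (p.1 : ℕ) + p.2) C := by
    rintro ⟨a, b⟩ hp ⟨c, d⟩ hq h
    simp only at h
    have h1 := hchain _ hp _ hq
    have h2 := hchain _ hq _ hp
    simp only [Fin.lt_def, Fin.le_def] at h1 h2
    ext <;> simp <;> omega
  have hsub : C.image (fun p : Fin n₁ × Fin n₂ => (p.1 : ℕ) + p.2) ⊆ Finset.range (n₁ + n₂ - 1) := by
    intro s hs
    simp only [Finset.mem_image, Finset.mem_range] at hs ⊢
    obtain ⟨p, _, rfl⟩ := hs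
    have := p.1.2
    have := p.2.2
    omega
  have hci := Finset.card_image_of_injOn hinj
  have heq := Finset.eq_of_subset_of_card_le hsub (by rw [hci]; simpa using hcard)
  refine ⟨?_, ?_⟩
  · rw [← hci, heq]; simp
  · intro s hs
    have : s ∈ C.image (fun p : Fin n₁ × Fin n₂ => (p.1 : ℕ) + p.2) := by
      rw [heq]; simpa using hs
    simpa using this

lemma core {N : ℕ} (G : SimpleGraph (Fin N)) [DecidableRel G.Adj]
    (Vu Vv : Finset (Fin N)) (hdis : Disjoint Vu Vv)
    (hcover : Vu ∪ Vv = Finset.univ)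
    (n₁ n₂ : ℕ) (hn₁ : 0 < n₁) (hn₂ : 0 < n₂) (hN : N = n₁ + n₂)
    (x : Fin n₁ → Fin N) (y : Fin n₂ → Fin N)
    (hx : Function.Injective x) (hy : Function.Injective y)
    (hxr : ∀ v : Fin N, v ∈ Vu ↔ ∃ i, x i = v)
    (hyr : ∀ v : Fin N, v ∈ Vv ↔ ∃ i, y i = v)
    (hch : ∀ i i' j j', G.Adj (x i) (y j) → G.Adj (x i') (y j') → i < i' → j ≤ j')
    (hcard : N - 1 ≤ ((Vu ×ˢ Vv).filter (fun p => G.Adj p.1 p.2)).card) :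
    ∃ L : List (Fin N),
      IsStemPath G Vu Vv y hn₂ L ∧
      (∀ L' : List (Fin N), IsStemPath G Vu Vv y hn₂ L' → L' = L) ∧
      L.length ≤ n₁ + n₂ ∧
      (∀ w ∈ Vu, w ∉ L → ∃! z : Fin N, z ∈ Vv ∧ G.Adj w z) ∧
      (∀ w ∈ Vv, w ∉ L → ∃! z : Fin N, z ∈ Vu ∧ G.Adj w z) := by
  classical
  have hnot : ∀ v, v ∉ Vu ↔ v ∈ Vv := by
    intro v
    constructor
    · intro h
      have : v ∈ Vu ∪ Vv := by rw [hcover]; simp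
      exact (Finset.mem_union.1 this).resolve_left h
    · intro h h'
      exact Finset.disjoint_left.1 hdis h' h
  have hxU : ∀ i, x i ∈ Vu := fun i => (hxr _).2 ⟨i, rfl⟩
  have hyV : ∀ i, y i ∈ Vv := fun i => (hyr _).2 ⟨i, rfl⟩
  have hyU : ∀ i, y i ∉ Vu := fun i => (hnot _).2 (hyV i)
  set C : Finset (Fin n₁ × Fin n₂) := Finset.univ.filter (fun p => G.Adj (x p.1) (y p.2)) with hC
  have hCc : n₁ + n₂ - 1 ≤ C.card := by
    rw [← hN]
    refine hcard.trans ?_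
    have : ((Vu ×ˢ Vv).filter (fun p => G.Adj p.1 p.2)) ⊆ C.image (fun p => (x p.1, y p.2)) := by
      rintro ⟨v, w⟩ h
      simp only [Finset.mem_filter, Finset.mem_product] at h
      obtain ⟨i, rfl⟩ := (hxr _).1 h.1.1
      obtain ⟨j, rfl⟩ := (hyr _).1 h.1.2
      exact Finset.mem_image.2 ⟨(i, j), by simpa [hC] using h.2, rfl⟩
    exact (Finset.card_le_card this).trans Finset.card_image_le
  obtain ⟨hCcard, hsurj⟩ := diag_surj C hn₁ hn₂ (by
    intro p hp q hq
    simp only [hC, Finset.mem_filter, Finset.mem_univ, true_and] at hp hq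
    exact hch _ _ _ _ hp hq) hCc
  set H := crossGraph G Vu with hH
  have hHxy : ∀ i j, G.Adj (x i) (y j) → H.Adj (x i) (y j) := fun i j h =>
    ⟨h, by simp [hxU i, hyU j]⟩
  set y0 := y ⟨0, hn₂⟩ with hy0
  set yl := y ⟨n₂ - 1, Nat.sub_lt hn₂ Nat.one_pos⟩ with hyl
  -- connectivity
  have hreach : ∀ s, s < n₁ + n₂ - 1 → ∀ p ∈ C, (p.1 : ℕ) + p.2 = s →
      (∀ k, k ≤ p.1 → H.Reachable y0 (x k)) ∧ (∀ l, l ≤ p.2 → H.Reachable y0 (y l)) := by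
    intro s
    induction s with
    | zero =>
      rintro hs ⟨i, j⟩ hp h
      simp only [hC, Finset.mem_filter, Finset.mem_univ, true_and] at hp h ⊢
      have hj : j = ⟨0, hn₂⟩ := Fin.ext (by simp; omega)
      refine ⟨?_, ?_⟩
      · intro k hk
        have : k = i := Fin.ext (by rw [Fin.le_def] at hk; omega)
        subst this
        subst hj
        exact (hHxy _ _ hp).symm.reachable
      · intro l hl
        have : l = ⟨0, hn₂⟩ := Fin.ext (by rw [Fin.le_def] at hl; simp; omega)
        subst this
        rfl
    | succ s ih =>
      rintro hs ⟨i, j⟩ hp h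
      obtain ⟨⟨i', j'⟩, hp', h'⟩ := hsurj s (by omega)
      obtain ⟨ih1, ih2⟩ := ih (by omega) _ hp' h'
      simp only [hC, Finset.mem_filter, Finset.mem_univ, true_and] at hp hp' h h' ih1 ih2 ⊢
      have c1 := hch _ _ _ _ hp hp'
      have c2 := hch _ _ _ _ hp' hp
      simp only [Fin.lt_def, Fin.le_def] at c1 c2 ih1 ih2 ⊢
      have hA := hHxy _ _ hp
      have hcase : ((i : ℕ) = i' ∧ (j : ℕ) = j' + 1) ∨ ((i : ℕ) = i' + 1 ∧ (j : ℕ) = j') := by omega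
      rcases hcase with ⟨e1, e2⟩ | ⟨e1, e2⟩
      · refine ⟨fun k hk => ih1 k (by omega), fun l hl => ?_⟩
        by_cases hl' : (l : ℕ) ≤ j'
        · exact ih2 l hl'
        · have : l = j := Fin.ext (by omega)
          subst this
          exact (ih1 i (by omega)).trans hA.reachable
      · refine ⟨fun k hk => ?_, fun l hl => ih2 l (by omega)⟩
        by_cases hk' : (k : ℕ) ≤ i'
        · exact ih1 k hk'
        · have : k = i := Fin.ext (by omega)
          subst this
          exact (ih2 j (by omega)).trans hA.symm.reachable
  have hreach0 : ∀ v, H.Reachable y0 v := by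
    obtain ⟨⟨i, j⟩, hp, h⟩ := hsurj (n₁ + n₂ - 2) (by omega)
    obtain ⟨r1, r2⟩ := hreach _ (by omega) _ hp h
    simp only at h r1 r2
    have := i.2
    have := j.2
    intro v
    by_cases hv : v ∈ Vu
    · obtain ⟨k, rfl⟩ := (hxr _).1 hv
      exact r1 k (by rw [Fin.le_def]; omega)
    · obtain ⟨k, rfl⟩ := (hyr _).1 ((hnot _).1 hv)
      exact r2 k (by rw [Fin.le_def]; omega)
  have hconn : H.Connected := by
    have : Nonempty (Fin N) := ⟨y0⟩
    exact ⟨fun a b => (hreach0 a).symm.trans (hreach0 b)⟩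
  have hHadj : ∀ v w, H.Adj v w → v ∈ Vu → ∃ i j, x i = v ∧ y j = w ∧ G.Adj (x i) (y j) := by
    intro v w h hv
    obtain ⟨i, rfl⟩ := (hxr _).1 hv
    obtain ⟨j, rfl⟩ := (hyr _).1 ((hnot _).1 (h.2.1 hv))
    exact ⟨i, j, rfl, rfl, h.1⟩
  have hHadj' : ∀ v w, H.Adj v w → v ∉ Vu → ∃ i j, y j = v ∧ x i = w ∧ G.Adj (x i) (y j) := by
    intro v w h hv
    have hw : w ∈ Vu := by
      by_contra hw
      exact hv (h.2.2 hw)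
    obtain ⟨i, j, a, b, c⟩ := hHadj w v h.symm hw
    exact ⟨i, j, b, a, c⟩
  have htree : H.IsTree := by
    rw [SimpleGraph.isTree_iff_connected_and_card]
    refine ⟨hconn, ?_⟩
    have h1 := hconn.card_vert_le_card_edgeSet_add_one
    have h2 : Nat.card H.edgeSet ≤ C.card := by
      have : H.edgeFinset ⊆ C.image (fun p => s(x p.1, y p.2)) := by
        intro e
        induction e using Sym2.ind with
        | _ v w =>
          intro he
          have he : H.Adj v w := by simpa using he
          rw [Finset.mem_image]
          by_cases hv : v ∈ Vu
          · obtain ⟨i, j, rfl, rfl, h⟩ := hHadj v w he hv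
            exact ⟨(i, j), by simpa [hC] using h, rfl⟩
          · obtain ⟨i, j, rfl, rfl, h⟩ := hHadj' v w he hv
            exact ⟨(i, j), by simpa [hC] using h, Sym2.eq_swap⟩
      have h3 := (Finset.card_le_card this).trans Finset.card_image_le
      rwa [SimpleGraph.edgeFinset_card, ← Nat.card_eq_fintype_card] at h3
    have h4 : Nat.card (Fin N) = N := by simp
    omega
  obtain ⟨P, hP, hPu⟩ := htree.existsUnique_path y0 yl
  have halt : ∀ i : ℕ, ∀ hi : i < P.support.length,
      (Even i → P.support.get ⟨i, hi⟩ ∈ Vv) ∧ (¬ Even i → P.support.get ⟨i, hi⟩ ∈ Vu) := by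
    intro i
    induction i with
    | zero =>
      intro hi
      simp only [Even.zero, not_true, false_imp_iff, and_true, true_imp_iff]
      have : P.support.get ⟨0, hi⟩ = y0 := by
        simp [List.get_eq_getElem]
      rw [this]; exact hyV _
    | succ i ih =>
      intro hi
      have hi' := ih (by omega)
      have hA := P.isChain_adj_support.getElem i hi
      simp only [List.get_eq_getElem] at hi' ⊢
      have h2 := hA.2
      rw [← hnot] at hi' ⊢
      rw [Nat.even_add_one]
      tauto
  have hcut : ∀ S : Set (Fin N), y0 ∈ S → yl ∉ S → ∀ w, w ∉ P.support →
      (∀ a b, a ≠ w → b ≠ w → H.Adj a b → a ∈ S → b ∈ S) → False := by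
    intro S h0 hl w hw h
    obtain ⟨d, hd, h1, h2⟩ := P.exists_boundary_dart S h0 hl
    refine h2 (h d.fst d.snd ?_ ?_ d.adj h1)
    · rintro rfl; exact hw (P.dart_fst_mem_support_of_mem_darts hd)
    · rintro rfl; exact hw (P.dart_snd_mem_support_of_mem_darts hd)
  have hnbr : ∀ w, (∃ v, v ≠ w) → ∃ z, H.Adj w z := by
    rintro w ⟨v, hv⟩
    obtain ⟨Q⟩ := hconn.preconnected w v
    obtain ⟨d, hd, h1, h2⟩ := Q.exists_boundary_dart {w} rfl hv
    have h1 : d.fst = w := h1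
    exact ⟨d.snd, h1 ▸ d.adj⟩
  refine ⟨P.support, ⟨by simp, hP.support_nodup, ?_, halt, ?_, ?_⟩, ?_, ?_, ?_, ?_⟩
  · exact P.isChain_adj_support.imp (fun a b h => h.1)
  · rw [List.head?_eq_some_head (by simp)]; simp [hy0]
  · rw [List.getLast?_eq_some_getLast (by simp)]; simp [hyl]
  · rintro L' ⟨hne, hnd, hc, ha, hh, hl⟩
    have hc' : L'.IsChain H.Adj := by
      rw [List.isChain_iff_getElem]
      intro i hi
      have h1 : G.Adj _ _ := List.IsChain.getElem hc i hi
      refine ⟨h1, ?_⟩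
      have h2 := ha i (by omega)
      have h3 := ha (i+1) hi
      simp only [List.get_eq_getElem, ← hnot, Nat.even_add_one] at h2 h3
      tauto
    have e1 : L'.head hne = y0 := by
      rw [List.head?_eq_some_head hne] at hh; simpa using hh
    have e2 : L'.getLast hne = yl := by
      rw [List.getLast?_eq_some_getLast hne] at hl; simpa using hl
    have h5 := hPu ((SimpleGraph.Walk.ofSupport L' hne hc').copy e1 e2) 
      ((SimpleGraph.Walk.isPath_def _).2 (by simpa using hnd))
    rw [← h5]; simp
  · have := hP.support_nodup.length_le_card
    simpa [hN] using this
  · intro w hw hwL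
    obtain ⟨z, hz⟩ := hnbr w ⟨y0, fun e => hyU _ (e ▸ hw)⟩
    obtain ⟨i, j, rfl, rfl, hA⟩ := hHadj _ _ hz hw
    have key : ∀ j j', G.Adj (x i) (y j) → G.Adj (x i) (y j') → ¬ j < j' := by
      intro j j' h h' hlt
      refine hcut {v | (∃ l, y l = v ∧ l ≤ j) ∨ (∃ k, x k = v ∧ k < i)} ?_ ?_ _ hwL ?_
      · exact Or.inl ⟨_, rfl, by simp [Fin.le_def]⟩
      · rintro (⟨l, h1, h2⟩ | ⟨k, h1, h2⟩)
        · have := hy h1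
          subst this
          have := j'.2
          simp only [Fin.le_def, Fin.lt_def] at h2 hlt
          omega
        · exact hyU _ (h1 ▸ hxU k)
      · intro a b ha hb hab hS
        by_cases haU : a ∈ Vu
        · obtain ⟨k, l, rfl, rfl, hkl⟩ := hHadj _ _ hab haU
          rcases hS with ⟨l', h1, h2⟩ | ⟨k', h1, h2⟩
          · exact absurd haU (h1 ▸ hyU l')
          · have := hx h1
            subst this
            exact Or.inl ⟨l, rfl, hch _ _ _ _ hkl h h2⟩
        · obtain ⟨k, l, rfl, rfl, hkl⟩ := hHadj' _ _ hab haU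
          rcases hS with ⟨l', h1, h2⟩ | ⟨k', h1, h2⟩
          · have := hy h1
            subst this
            refine Or.inr ⟨k, rfl, ?_⟩
            have hki : k ≠ i := fun e => hb (by rw [e])
            by_contra hcon
            have := hch _ _ _ _ h' hkl (lt_of_le_of_ne (not_lt.1 hcon) hki.symm)
            exact absurd (lt_of_le_of_lt h2 hlt) (not_lt.2 this)
          · exact absurd (h1 ▸ hxU k') haU
    refine ⟨y j, ⟨hyV j, hA⟩, ?_⟩
    rintro z ⟨hz1, hz2⟩
    obtain ⟨j', rfl⟩ := (hyr _).1 hz1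
    have := key _ _ hA hz2
    have := key _ _ hz2 hA
    congr 1
    omega
  · intro w hw hwL
    obtain ⟨z, hz⟩ := hnbr w ⟨x ⟨0, hn₁⟩, fun e => (hnot _).2 hw (e ▸ hxU _)⟩
    obtain ⟨i, j, rfl, rfl, hA⟩ := hHadj' _ _ hz ((hnot _).2 hw)
    have key : ∀ i i', G.Adj (x i) (y j) → G.Adj (x i') (y j) → ¬ i < i' := by
      intro i i' h h' hlt
      refine hcut {v | (∃ l, y l = v ∧ l < j) ∨ (∃ k, x k = v ∧ k ≤ i)} ?_ ?_ _ hwL ?_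
      · refine Or.inl ⟨_, rfl, ?_⟩
        have : j ≠ ⟨0, hn₂⟩ := by
          rintro rfl
          exact hwL P.start_mem_support
        rw [Fin.lt_def]
        rw [Ne, Fin.ext_iff] at this
        simp only at this ⊢
        omega
      · rintro (⟨l, h1, h2⟩ | ⟨k, h1, h2⟩)
        · have := hy h1
          subst this
          have := j.2
          simp only [Fin.lt_def] at h2
          omega
        · exact hyU _ (h1 ▸ hxU k)
      · intro a b ha hb hab hS
        by_cases haU : a ∈ Vu
        · obtain ⟨k, l, rfl, rfl, hkl⟩ := hHadj _ _ hab haU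
          rcases hS with ⟨l', h1, h2⟩ | ⟨k', h1, h2⟩
          · exact absurd haU (h1 ▸ hyU l')
          · have := hx h1
            subst this
            have hlj : l ≠ j := fun e => hb (by rw [e])
            exact Or.inl ⟨l, rfl, lt_of_le_of_ne (hch _ _ _ _ hkl h' (lt_of_le_of_lt h2 hlt)) hlj⟩
        · obtain ⟨k, l, rfl, rfl, hkl⟩ := hHadj' _ _ hab haU
          rcases hS with ⟨l', h1, h2⟩ | ⟨k', h1, h2⟩
          · have := hy h1
            subst this
            refine Or.inr ⟨k, rfl, ?_⟩
            by_contra hcon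
            have := hch _ _ _ _ h hkl (not_le.1 hcon)
            exact absurd h2 (not_lt.2 this)
          · exact absurd (h1 ▸ hxU k') haU
    refine ⟨x i, ⟨hxU i, hA.symm⟩, ?_⟩
    rintro z ⟨hz1, hz2⟩
    obtain ⟨i', rfl⟩ := (hxr _).1 hz1
    have := key _ _ hA hz2.symm
    have := key _ _ hz2.symm hA
    congr 1
    omega

lemma path_edge_mem {N n : ℕ} (G : SimpleGraph (Fin N)) (x : Fin n → Fin N)
    (hxp : ∀ i j : Fin n, G.Adj (x i) (x j) ↔ ((i : ℕ) + 1 = j ∨ (j : ℕ) + 1 = i))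
    (i j : Fin n) (h : G.Adj (x i) (x j)) :
    s(x i, x j) ∈ (Finset.univ : Finset (Fin (n-1))).image
      (fun k : Fin (n - 1) => s(x ⟨(k : ℕ), by omega⟩, x ⟨(k : ℕ) + 1, by omega⟩)) := by
  rw [Finset.mem_image]
  have hi := i.2
  have hj := j.2
  rcases (hxp i j).1 h with e | e
  · refine ⟨⟨i, by omega⟩, Finset.mem_univ _, ?_⟩
    have : j = ⟨(i : ℕ) + 1, by omega⟩ := Fin.ext e.symm
    exact congrArg (fun z => s(x i, x z)) this.symm
  · refine ⟨⟨j, by omega⟩, Finset.mem_univ _, ?_⟩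
    have : i = ⟨(j : ℕ) + 1, by omega⟩ := Fin.ext e.symm
    refine (congrArg (fun z => s(x j, x z)) this.symm).trans ?_
    exact Sym2.eq_swap

lemma cross_count {N : ℕ} (G : SimpleGraph (Fin N)) [DecidableRel G.Adj]
    (Vu Vv : Finset (Fin N))
    (hcover : Vu ∪ Vv = Finset.univ)
    (n₁ n₂ : ℕ) (hn₁ : 0 < n₁) (hn₂ : 0 < n₂) (hN : N = n₁ + n₂)
    (x : Fin n₁ → Fin N) (y : Fin n₂ → Fin N)
    (hxr : ∀ v : Fin N, v ∈ Vu ↔ ∃ i, x i = v)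
    (hyr : ∀ v : Fin N, v ∈ Vv ↔ ∃ i, y i = v)
    (hxp : ∀ i j : Fin n₁, G.Adj (x i) (x j) ↔ ((i : ℕ) + 1 = j ∨ (j : ℕ) + 1 = i))
    (hyp : ∀ i j : Fin n₂, G.Adj (y i) (y j) ↔ ((i : ℕ) + 1 = j ∨ (j : ℕ) + 1 = i))
    (hcard : G.edgeFinset.card = 2 * N - 3) :
    N - 1 ≤ ((Vu ×ˢ Vv).filter (fun p => G.Adj p.1 p.2)).card := by
  classical
  set A := (Finset.univ : Finset (Fin (n₁-1))).image
      (fun k : Fin (n₁ - 1) => s(x ⟨(k : ℕ), by omega⟩, x ⟨(k : ℕ) + 1, by omega⟩)) with hA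
  set B := (Finset.univ : Finset (Fin (n₂-1))).image
      (fun k : Fin (n₂ - 1) => s(y ⟨(k : ℕ), by omega⟩, y ⟨(k : ℕ) + 1, by omega⟩)) with hB
  set C := ((Vu ×ˢ Vv).filter (fun p => G.Adj p.1 p.2)).image (fun p => s(p.1, p.2)) with hC
  have hsub : G.edgeFinset ⊆ A ∪ B ∪ C := by
    intro e
    induction e using Sym2.ind with
    | _ v w =>
      intro he
      have he : G.Adj v w := by simpa using he
      have hv : v ∈ Vu ∪ Vv := by rw [hcover]; simp
      have hw : w ∈ Vu ∪ Vv := by rw [hcover]; simp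
      rw [Finset.mem_union] at hv hw
      rw [Finset.mem_union, Finset.mem_union]
      rcases hv with hv | hv <;> rcases hw with hw | hw
      · left; left
        obtain ⟨i, rfl⟩ := (hxr _).1 hv
        obtain ⟨j, rfl⟩ := (hxr _).1 hw
        exact path_edge_mem G x hxp i j he
      · right
        exact Finset.mem_image.2 ⟨(v, w), by simp [hv, hw, he], rfl⟩
      · right
        exact Finset.mem_image.2 ⟨(w, v), by simp [hv, hw, he.symm], Sym2.eq_swap⟩
      · left; right
        obtain ⟨i, rfl⟩ := (hyr _).1 hv
        obtain ⟨j, rfl⟩ := (hyr _).1 hw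
        exact path_edge_mem G y hyp i j he
  have h1 := Finset.card_le_card hsub
  have h2 := Finset.card_union_le (A ∪ B) C
  have h3 := Finset.card_union_le A B
  have h4 : A.card ≤ n₁ - 1 := Finset.card_image_le.trans (by simp)
  have h5 : B.card ≤ n₂ - 1 := Finset.card_image_le.trans (by simp)
  have h6 : C.card ≤ _ := Finset.card_image_le
  omega

/-- if an outerplanar triangulation `G` has its vertex set partitioned
into `Vu` (inducing the path `x 0 — ⋯ — x (n₁-1)`) and `Vv` (inducing the path
`y 0 — ⋯ — y (n₂-1)`), then there is a unique alternating stem path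
`v 1, u 1, v 2, …, u (ℓ-1), v ℓ` from `y 0` to `y (n₂-1)`; it has length
`2ℓ - 1 ≤ n₁ + n₂`, and every leaf (non-stem) vertex of `Vu` has exactly one
neighbour in `Vv`, and vice versa. -/
theorem stmt_15 {N : ℕ} (G : SimpleGraph (Fin N)) [DecidableRel G.Adj]
    (hG : IsOuterplanarTriangulation G)
    (Vu Vv : Finset (Fin N)) (hdis : Disjoint Vu Vv)
    (hcover : Vu ∪ Vv = Finset.univ)
    (n₁ n₂ : ℕ) (hn₂ : 0 < n₂)
    (x : Fin n₁ → Fin N) (y : Fin n₂ → Fin N)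
    (hx : Function.Injective x) (hy : Function.Injective y)
    (hxr : ∀ v : Fin N, v ∈ Vu ↔ ∃ i, x i = v)
    (hyr : ∀ v : Fin N, v ∈ Vv ↔ ∃ i, y i = v)
    (hxp : ∀ i j : Fin n₁, G.Adj (x i) (x j) ↔ ((i : ℕ) + 1 = j ∨ (j : ℕ) + 1 = i))
    (hyp : ∀ i j : Fin n₂, G.Adj (y i) (y j) ↔ ((i : ℕ) + 1 = j ∨ (j : ℕ) + 1 = i)) :
    ∃ L : List (Fin N),
      IsStemPath G Vu Vv y hn₂ L ∧
      (∀ L' : List (Fin N), IsStemPath G Vu Vv y hn₂ L' → L' = L) ∧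
      L.length ≤ n₁ + n₂ ∧
      (∀ w ∈ Vu, w ∉ L → ∃! z : Fin N, z ∈ Vv ∧ G.Adj w z) ∧
      (∀ w ∈ Vv, w ∉ L → ∃! z : Fin N, z ∈ Vu ∧ G.Adj w z) := by
  classical
  obtain ⟨hN3, σ, hcyc, hnc, hedge⟩ := hG
  have hnot : ∀ v, v ∉ Vu ↔ v ∈ Vv := by
    intro v
    constructor
    · intro h
      have : v ∈ Vu ∪ Vv := by rw [hcover]; simp
      exact (Finset.mem_union.1 this).resolve_left h
    · intro h h'
      exact Finset.disjoint_left.1 hdis h' h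
  have hcu : Vu.card = n₁ := by
    have : Vu = Finset.univ.image x := by ext v; simp [hxr]
    rw [this, Finset.card_image_of_injective _ hx]; simp
  have hcv : Vv.card = n₂ := by
    have : Vv = Finset.univ.image y := by ext v; simp [hyr]
    rw [this, Finset.card_image_of_injective _ hy]; simp
  have hN : N = n₁ + n₂ := by
    have := Finset.card_union_of_disjoint hdis
    rw [hcover, hcu, hcv] at this
    simpa using this
  have hn₁ : 0 < n₁ := by
    by_contra h0
    have h0 : n₁ = 0 := by omega
    have hall : ∀ v, v ∈ Vv := by
      intro v
      rw [← hnot, hxr]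
      rintro ⟨i, _⟩
      exact absurd i.2 (by omega)
    have hsub : G.edgeFinset ⊆ (Finset.univ : Finset (Fin (n₂-1))).image
      (fun k : Fin (n₂ - 1) => s(y ⟨(k : ℕ), by omega⟩, y ⟨(k : ℕ) + 1, by omega⟩)) := by
      intro e
      induction e using Sym2.ind with
      | _ v w =>
        intro he
        have he : G.Adj v w := by simpa using he
        obtain ⟨i, rfl⟩ := (hyr _).1 (hall v)
        obtain ⟨j, rfl⟩ := (hyr _).1 (hall w)
        exact path_edge_mem G y hyp i j he
    have h1 := (Finset.card_le_card hsub).trans Finset.card_image_le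
    rw [hedge] at h1
    simp at h1
    omega
  have hcount := cross_count G Vu Vv hcover n₁ n₂ hn₁ hn₂ hN x y hxr hyr hxp hyp hedge
  obtain ⟨g, hgs, hgi, hgnc, hga, hg0, hgl⟩ := rotate_exists G σ hN3 hcyc
    (fun a b c d h1 h2 h3 hA hB => hnc a b c d (h1.trans h2) (h2.trans h3) hA hB
      (Or.inl ⟨h1, h2, h3⟩)) Vu ⟨x ⟨0, hn₁⟩, (hxr _).2 ⟨_, rfl⟩⟩
      ⟨y ⟨0, hn₂⟩, (hnot _).2 ((hyr _).2 ⟨_, rfl⟩)⟩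
  have hlow : ∀ i j, i < j → j < N → g j ∈ Vu → g i ∈ Vu := by
    intro i j hij hj hjU
    by_contra hi
    have hi0 : i ≠ 0 := fun e => hi (e ▸ hg0)
    have hjl : j ≠ N - 1 := fun e => hgl (e ▸ hjU)
    exact no_alt G g hgs hgi hgnc Vu Vv (fun v hv h => (hnot v).2 h hv) x y hxr hyr
      (fun i j h => (hxp i j).2 (Or.inl h)) (fun i j h => (hyp i j).2 (Or.inl h))
      0 i j (N-1) (by omega) hij (by omega) (by omega) hg0 ((hnot _).1 hi) hjU ((hnot _).1 hgl)
  have hseg : ∀ t < N, (g t ∈ Vu ↔ t < n₁) := by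
    set T := (Finset.range N).filter (fun t => g t ∈ Vu) with hT
    have hTc : T.card = n₁ := by
      rw [← hcu, ← Finset.card_image_of_injOn (s := T) (f := g)]
      · congr 1
        ext v
        simp only [hT, Finset.mem_image, Finset.mem_filter, Finset.mem_range]
        constructor
        · rintro ⟨t, ht, rfl⟩; exact ht.2
        · intro hv
          obtain ⟨t, ht, rfl⟩ := hgs v
          exact ⟨t, ⟨ht, hv⟩, rfl⟩
      · intro s hs t ht h
        simp only [hT, Finset.coe_filter, Finset.mem_range, Set.mem_ofPred_eq] at hs ht
        exact hgi s hs.1 t ht.1 h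
    have hTs : T ⊆ Finset.range n₁ := by
      intro t ht
      simp only [hT, Finset.mem_filter, Finset.mem_range] at ht
      have : Finset.range (t+1) ⊆ T := by
        intro s hs
        simp only [hT, Finset.mem_filter, Finset.mem_range] at hs ⊢
        refine ⟨by omega, ?_⟩
        rcases Nat.lt_or_ge s t with h | h
        · exact hlow s t h ht.1 ht.2
        · rw [show s = t by omega]; exact ht.2
      have := Finset.card_le_card this
      simp only [Finset.card_range] at this
      simp only [Finset.mem_range]
      omega
    have hTe := Finset.eq_of_subset_of_card_le hTs (by simp [hTc])
    intro t ht
    have : t ∈ T ↔ t < n₁ := by rw [hTe]; simp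
    rw [← this]
    simp [hT, ht]
  -- the order of `y` along the cycle
  have hr : ∀ j : ℕ, ∃ k : ℕ, j < n₂ → ∃ hk : k < n₂, y ⟨k, hk⟩ = g (N - 1 - j) := by
    intro j
    by_cases hj : j < n₂
    · have h1 : g (N - 1 - j) ∈ Vv := by
        rw [← hnot, hseg _ (by omega)]; omega
      obtain ⟨k, hk⟩ := (hyr _).1 h1
      exact ⟨k, fun _ => ⟨k.2, hk⟩⟩
    · exact ⟨0, fun h => absurd h hj⟩
  choose r hr using hr
  have hrr := step_id_or_rev n₂ r (fun j hj => (hr j hj).1) (by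
      intro i hi j hj h
      obtain ⟨_, e1⟩ := hr i hi
      obtain ⟨_, e2⟩ := hr j hj
      have : g (N - 1 - i) = g (N - 1 - j) := by rw [← e1, ← e2]; simp [h]
      have := hgi _ (by omega) _ (by omega) this
      omega) (by
      intro j hj
      obtain ⟨h1, e1⟩ := hr j (by omega)
      obtain ⟨h2, e2⟩ := hr (j+1) hj
      have h3 := hga (N - 1 - (j + 1))
      rw [show N - 1 - (j+1) + 1 = N - 1 - j by omega, ← e1, ← e2, hyp] at h3
      simp only at h3
      tauto)
  have hxr' : ∀ v, v ∈ Vu ↔ ∃ i : Fin n₁, g i = v := by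
    intro v
    obtain ⟨t, ht, rfl⟩ := hgs v
    rw [hseg t ht]
    constructor
    · intro h; exact ⟨⟨t, h⟩, rfl⟩
    · rintro ⟨i, hi⟩
      have := hgi _ (by omega) _ ht hi
      omega
  rcases hrr with hid | hrev
  · have hyg : ∀ j : Fin n₂, y j = g (N - 1 - j) := by
      intro j
      obtain ⟨h1, e⟩ := hr j j.2
      rw [← e]
      congr 1
      exact Fin.ext (hid j j.2).symm
    refine core G Vu Vv hdis hcover n₁ n₂ hn₁ hn₂ hN (fun i => g i) y ?_ hy hxr' hyr ?_ hcount
    · intro i j h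
      exact Fin.ext (hgi _ (by omega) _ (by omega) h)
    · intro i i' j j' h h' hlt
      by_contra hcon
      rw [hyg] at h h'
      rw [Fin.lt_def] at hlt
      rw [Fin.le_def] at hcon
      exact hgnc i i' (N - 1 - j) (N - 1 - j') hlt (by omega) (by omega) (by omega) h h'
  · have hyg : ∀ j : Fin n₂, y j = g (n₁ + j) := by
      intro j
      obtain ⟨h1, e⟩ := hr (n₂ - 1 - j) (by omega)
      rw [show n₁ + (j : ℕ) = N - 1 - (n₂ - 1 - j) by omega, ← e]
      congr 1
      apply Fin.ext
      simp only [hrev (n₂ - 1 - j) (by omega)]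
      omega
    refine core G Vu Vv hdis hcover n₁ n₂ hn₁ hn₂ hN (fun i => g (n₁ - 1 - i)) y ?_ hy ?_ hyr ?_ hcount
    · intro i j h
      have := hgi _ (by omega) _ (by omega) h
      exact Fin.ext (by omega)
    · intro v
      rw [hxr']
      constructor
      · rintro ⟨i, rfl⟩
        exact ⟨⟨n₁ - 1 - i, by omega⟩, by simp only; congr 1; omega⟩
      · rintro ⟨i, rfl⟩
        exact ⟨⟨n₁ - 1 - i, by omega⟩, rfl⟩
    · intro i i' j j' h h' hlt
      by_contra hcon
      rw [hyg] at h h'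
      rw [Fin.lt_def] at hlt
      rw [Fin.le_def] at hcon
      exact hgnc (n₁ - 1 - i') (n₁ - 1 - i) (n₁ + j') (n₁ + j) (by omega) (by omega) (by omega)
        (by omega) h' h
end
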